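/- arXiv:2205.15297 — 3 statements merged into one kernel-verified Lean document; each statement's English description precedes it below -/
import Mathlib

section
/- Let (R,m,k) be a Cohen–Macaulay Noetherian local ring of dimension d ≥ 1. Then R is a regular local ring if and only if there exists a finitely generated nonzero R-module N of finite injective dimension such that Ext^1_R(Ω^{d−1}_R k, N)^μ = 0, i.e., such that every μ-additive short exact sequence 0 → N → X → Ω^{d−1}_R k → 0 of finitely generated R-modules splits. -/
open IsLocalRing

/-- The minimal number of generators `μ(M) = dim_k (M/𝔪M)` of a module over a local ring. -/
noncomputable def mu (R : Type) [CommRing R] [IsLocalRing R]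
    (M : Type) [AddCommGroup M] [Module R M] : ℕ :=
  Module.finrank (R ⧸ maximalIdeal R)
    (M ⧸ (maximalIdeal R • ⊤ : Submodule R M))

/-- A local ring is regular if its maximal ideal is generated by `dim R` elements. -/
def IsRegularLocal (R : Type) [CommRing R] [IsLocalRing R] : Prop :=
  ∃ (n : ℕ) (x : Fin n → R), Ideal.span (Set.range x) = maximalIdeal R ∧
    ringKrullDim R = n

/-- `depth ≥ n`: there is an `M`-regular sequence of length `n` inside the maximal ideal. -/
def depthGE (R : Type) [CommRing R] [IsLocalRing R]
    (M : Type) [AddCommGroup M] [Module R M] (n : ℕ) : Prop :=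
  ∃ rs : List R, rs.length = n ∧ (∀ r ∈ rs, r ∈ maximalIdeal R) ∧
    RingTheory.Sequence.IsRegular M rs

/-- `S` is an `i`-th syzygy of the residue field `k` in a minimal free resolution:
there is a minimal free resolution `⋯ → F₁ → F₀ → k → 0` (all differentials having image
inside `𝔪 • F`) such that `S ≅ k` if `i = 0` and `S ≅ image (F_i → F_{i-1})` if `i ≥ 1`. -/
def IsMinSyzygyOfResidueField (R : Type) [CommRing R] [IsLocalRing R] (i : ℕ)
    (S : Type) [AddCommGroup S] [Module R S] : Prop :=
  ∃ (b : ℕ → ℕ) (f : ∀ j : ℕ, ((Fin (b (j+1)) → R) →ₗ[R] (Fin (b j) → R)))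
    (ε : (Fin (b 0) → R) →ₗ[R] R ⧸ maximalIdeal R),
    Function.Surjective ε ∧
    Function.Exact (f 0) ε ∧
    (∀ j, Function.Exact (f (j+1)) (f j)) ∧
    LinearMap.ker ε ≤ (maximalIdeal R) • (⊤ : Submodule R (Fin (b 0) → R)) ∧
    (∀ j, LinearMap.range (f j) ≤ (maximalIdeal R) • (⊤ : Submodule R (Fin (b j) → R))) ∧
    ((i = 0 ∧ Nonempty (S ≃ₗ[R] R ⧸ maximalIdeal R)) ∨
      (∃ j, i = j + 1 ∧ Nonempty (S ≃ₗ[R] LinearMap.range (f j))))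

/-- `N` has finite injective dimension: there is a finite injective resolution
`0 → N → I⁰ → ⋯ → Iⁿ → 0`. -/
def HasFiniteInjDim (R : Type) [CommRing R] (N : Type) [AddCommGroup N] [Module R N] : Prop :=
  ∃ (n : ℕ) (I : ℕ → ModuleCat.{0} R) (f : ∀ j : ℕ, (I j →ₗ[R] I (j+1)))
    (ι : N →ₗ[R] I 0),
    (∀ j, Module.Injective R (I j)) ∧
    Function.Injective ι ∧
    Function.Exact ι (f 0) ∧
    (∀ j, Function.Exact (f j) (f (j+1))) ∧
    (∀ j, n < j → Subsingleton (I j))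

open IsLocalRing
open CategoryTheory CategoryTheory.Abelian

set_option linter.unusedSectionVars false

section general
variable {R : Type} [CommRing R]

/-- concrete short exact sequences of modules -/
lemma aux_shortExact {A B C : Type} [AddCommGroup A] [AddCommGroup B] [AddCommGroup C]
    [Module R A] [Module R B] [Module R C] (f : A →ₗ[R] B) (g : B →ₗ[R] C)
    (hf : Function.Injective f) (hg : Function.Surjective g) (h : Function.Exact f g) :
    (ModuleCat.shortComplexOfCompEqZero f g h.linearMap_comp_eq_zero).ShortExact where
  exact := ModuleCat.shortComplex_exact _ h
  mono_f := by simpa [ModuleCat.mono_iff_injective] using! hf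
  epi_g := by simpa [ModuleCat.epi_iff_surjective] using! hg

/-- Baer's criterion via `Ext`. -/
lemma aux_baer (N : ModuleCat.{0} R)
    (h : ∀ I : Ideal R, Subsingleton (Ext (ModuleCat.of R (R ⧸ I)) N 1)) :
    HasInjectiveDimensionLT N 1 := by
  have : Module.Injective R N := by
    rw [← Module.Baer.iff_injective]
    intro I g
    have hS := aux_shortExact (R := R) I.subtype I.mkQ I.injective_subtype I.mkQ_surjective
      (LinearMap.exact_subtype_mkQ I)
    obtain ⟨x, hx⟩ := Ext.contravariant_sequence_exact₁ hS N
      (Ext.mk₀ (ModuleCat.ofHom g)) (add_zero 1) (by have := h I; exact Subsingleton.elim (α := Ext (ModuleCat.of R (R ⧸ I)) N 1) _ _)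
    obtain ⟨u, rfl⟩ := (Ext.mk₀_bijective _ _).2 x
    rw [Ext.mk₀_comp_mk₀] at hx
    have := (Ext.mk₀_bijective _ _).1 hx
    refine ⟨u.hom, fun x hx => ?_⟩
    have h2 := congrArg (fun t => t.hom ⟨x, hx⟩) this
    simpa using h2
  have : Injective N := (Module.injective_iff_injective_object R N).1 this
  infer_instance

lemma aux_cosyz (N : ModuleCat.{0} R) : ∃ S : ShortComplex (ModuleCat.{0} R), S.ShortExact ∧
    S.X₁ = N ∧ Injective S.X₂ := by
  refine ⟨ShortComplex.mk (Injective.ι N) (Limits.cokernel.π _) (Limits.cokernel.condition _),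
    ?_, rfl, ?_⟩
  · exact { exact := ShortComplex.exact_cokernel _ }
  · dsimp; infer_instance

lemma aux_injdim (n : ℕ) : ∀ (N : ModuleCat.{0} R)
    (_ : ∀ I : Ideal R, Subsingleton (Ext (ModuleCat.of R (R ⧸ I)) N (n + 1))),
    HasInjectiveDimensionLT N (n + 1) := by
  induction n with
  | zero => exact fun N h => aux_baer N h
  | succ n ih =>
    intro N h
    obtain ⟨S, hS, rfl, hi⟩ := aux_cosyz N
    rw [← hS.hasInjectiveDimensionLT_X₃_iff n hi]
    apply ih
    intro I
    refine subsingleton_of_forall_eq 0 fun x => ?_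
    have hx : x.comp hS.extClass (rfl : n + 1 + 1 = _) = 0 := by
      have := h I; exact Subsingleton.elim _ _
    obtain ⟨y, rfl⟩ := Ext.covariant_sequence_exact₃ _ hS x rfl hx
    rw [Ext.eq_zero_of_injective y, Ext.zero_comp]

end general

section bass
variable {R : Type} [CommRing R] [IsLocalRing R] [IsNoetherianRing R]

/-- contravariant: outer vanishing gives middle vanishing -/
lemma aux_mid {S : ShortComplex (ModuleCat.{0} R)} (hS : S.ShortExact) (N : ModuleCat.{0} R)
    (i : ℕ) (h1 : Subsingleton (Ext S.X₁ N i)) (h3 : Subsingleton (Ext S.X₃ N i)) :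
    Subsingleton (Ext S.X₂ N i) := by
  refine subsingleton_of_forall_eq 0 fun x => ?_
  obtain ⟨y, rfl⟩ := Ext.contravariant_sequence_exact₂ hS N x (Subsingleton.elim _ _)
  rw [Subsingleton.elim y 0, Ext.comp_zero]

lemma aux_iso {A B : ModuleCat.{0} R} (e : A ≅ B) (N : ModuleCat.{0} R) (i : ℕ)
    (h : Subsingleton (Ext A N i)) : Subsingleton (Ext B N i) := by
  refine subsingleton_of_forall_eq 0 fun x => ?_
  have : x = (Ext.mk₀ e.inv).comp ((Ext.mk₀ e.hom).comp x (zero_add i)) (zero_add i) := by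
    rw [Ext.mk₀_comp_mk₀_assoc]; simp
  rw [this, Subsingleton.elim ((Ext.mk₀ e.hom).comp x (zero_add i)) 0, Ext.comp_zero]

lemma aux_bass_prime (N : ModuleCat.{0} R) [Module.Finite R N] (e : ℕ)
    (h : ∀ i, e < i → Subsingleton (Ext (ModuleCat.of R (R ⧸ maximalIdeal R)) N i)) :
    ∀ I : Ideal R, ∀ i, e < i → Subsingleton (Ext (ModuleCat.of R (R ⧸ I)) N i) := by
  intro I
  -- a general devissage: for finite modules whose support avoids...
  induction I using IsNoetherian.induction with
  | _ I ih =>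
  -- step A : all modules with annihilator strictly containing
  have hA : ∀ (M : Type) [AddCommGroup M] [Module R M] [Module.Finite R M]
      (J : Ideal R), I < J → (∀ r ∈ J, ∀ x : M, r • x = 0) →
      ∀ i, e < i → Subsingleton (Ext (ModuleCat.of R M) N i) := by
    intro M _ _ hM
    induction hM using IsNoetherianRing.induction_on_isQuotientEquivQuotientPrime R with
    | subsingleton M =>
      intro J _ _ i hi
      refine subsingleton_of_forall_eq 0 fun x => ?_
      have : Limits.IsZero (ModuleCat.of R M) := ModuleCat.isZero_of_subsingleton _
      have : (𝟙 (ModuleCat.of R M)) = 0 := this.eq_of_src _ _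
      rw [← Ext.mk₀_id_comp x, this]; simp
    | quotient M p eqv =>
      intro J hJ hann i hi
      have hJp : J ≤ p.1 := by
        intro r hr
        have := hann r hr (eqv.symm (Ideal.Quotient.mk _ 1))
        rw [← map_smul, LinearEquiv.map_eq_zero_iff] at this
        rw [← Ideal.Quotient.eq_zero_iff_mem]
        simpa [Algebra.smul_def] using this
      exact aux_iso eqv.toModuleIso.symm N i (ih p.1 (lt_of_lt_of_le hJ hJp) i hi)
    | exact M₁ M₂ M₃ f g hf hg hfg h₁ h₃ =>
      intro J hJ hann i hi
      refine aux_mid (aux_shortExact f g hf hg hfg) N i (h₁ J hJ ?_ i hi) (h₃ J hJ ?_ i hi)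
      · intro r hr x; apply hf; rw [map_smul, hann r hr, map_zero]
      · intro r hr x; obtain ⟨x, rfl⟩ := hg x; rw [← map_smul, hann r hr, map_zero]
  intro i hi
  by_cases hI : I = ⊤
  · subst hI
    refine subsingleton_of_forall_eq 0 fun x => ?_
    have : Limits.IsZero (ModuleCat.of R (R ⧸ (⊤ : Ideal R))) := ModuleCat.isZero_of_subsingleton _
    have : (𝟙 (ModuleCat.of R (R ⧸ (⊤ : Ideal R)))) = 0 := this.eq_of_src _ _
    rw [← Ext.mk₀_id_comp x, this]; simp
  by_cases hm : I = maximalIdeal R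
  · subst hm; exact h i hi
  have hlt : I < maximalIdeal R := lt_of_le_of_ne (le_maximalIdeal hI) hm
  obtain ⟨z, hzm, hzI⟩ := SetLike.exists_of_lt hlt
  by_cases hreg : ∀ a, z * a ∈ I → a ∈ I
  · -- 0 → R/I → R/I → R/(I,z) → 0
    have hreg' : IsSMulRegular (ModuleCat.of R (R ⧸ I)) z := by
      rw [isSMulRegular_iff_right_eq_zero_of_smul]
      intro x hx
      obtain ⟨a, rfl⟩ := Ideal.Quotient.mk_surjective x
      rw [Algebra.smul_def, Ideal.Quotient.algebraMap_eq, ← map_mul, Ideal.Quotient.eq_zero_iff_mem] at hx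
      exact Ideal.Quotient.eq_zero_iff_mem.2 (hreg a hx)
    have hS := hreg'.smulShortComplex_shortExact
    have h3 : Subsingleton (Ext ((ModuleCat.of R (R ⧸ I)).smulShortComplex z).X₃ N (1 + i)) := by
      refine hA (QuotSMulTop z (R ⧸ I)) (I ⊔ Ideal.span {z}) ?_ ?_ (1+i) (by omega)
      · rw [lt_iff_le_and_ne]
        refine ⟨le_sup_left, fun h => hzI ?_⟩
        rw [h]; exact Ideal.mem_sup_right (Ideal.mem_span_singleton_self z)
      · intro r hr x
        obtain ⟨x, rfl⟩ := Submodule.mkQ_surjective _ x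
        obtain ⟨x, rfl⟩ := Ideal.Quotient.mk_surjective x
        obtain ⟨a, ha, b, hb, rfl⟩ := Submodule.mem_sup.1 hr
        obtain ⟨c, rfl⟩ := Ideal.mem_span_singleton.1 hb
        rw [← map_smul, Submodule.mkQ_apply, Submodule.Quotient.mk_eq_zero, add_smul]
        have : a • (Ideal.Quotient.mk I x) = 0 := by
          rw [Algebra.smul_def, Ideal.Quotient.algebraMap_eq, ← map_mul, Ideal.Quotient.eq_zero_iff_mem]
          exact Ideal.mul_mem_right _ I ha
        rw [this, zero_add, mul_smul]
        exact Submodule.smul_mem_pointwise_smul _ _ _ trivial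
    have hN : (⊤ : Submodule R (Ext (ModuleCat.of R (R ⧸ I)) N i)) = ⊥ := by
      have hfin : Module.Finite R (Ext (ModuleCat.of R (R ⧸ I)) N i) := inferInstance
      refine Submodule.eq_bot_of_le_smul_of_le_jacobson_bot (maximalIdeal R) _
        hfin.1 ?_ (maximalIdeal_le_jacobson _)
      intro x _
      obtain ⟨y, rfl⟩ := Ext.contravariant_sequence_exact₁ hS N x rfl (Subsingleton.elim _ _)
      have : ∀ y : Ext (ModuleCat.of R (R ⧸ I)) N i,
          (Ext.mk₀ (z • 𝟙 (ModuleCat.of R (R ⧸ I)))).comp y (zero_add i) ∈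
            maximalIdeal R • (⊤ : Submodule R (Ext (ModuleCat.of R (R ⧸ I)) N i)) := by
        intro y
        rw [Ext.mk₀_smul, Ext.smul_comp]
        exact Submodule.smul_mem_smul hzm trivial
      exact this y
    rw [← Submodule.subsingleton_iff R, ← subsingleton_iff_bot_eq_top] 
    exact hN.symm
  · -- R/I ⊃ a(R/I)
    push Not at hreg
    obtain ⟨a, hza, haI⟩ := hreg
    let K : Submodule R (R ⧸ I) := Submodule.map I.mkQ (Ideal.span {a})
    have hS := aux_shortExact K.subtype K.mkQ K.injective_subtype K.mkQ_surjective
      (LinearMap.exact_subtype_mkQ K)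
    refine aux_mid hS N i ?_ ?_
    · refine hA K (I ⊔ Ideal.span {z}) ?_ ?_ i hi
      · rw [lt_iff_le_and_ne]
        refine ⟨le_sup_left, fun h => hzI ?_⟩
        rw [h]; exact Ideal.mem_sup_right (Ideal.mem_span_singleton_self z)
      · rintro r hr ⟨x, hx⟩
        obtain ⟨x, hx, rfl⟩ := hx
        obtain ⟨u, rfl⟩ := Ideal.mem_span_singleton.1 hx
        obtain ⟨b, hb, c, hc, rfl⟩ := Submodule.mem_sup.1 hr
        obtain ⟨c, rfl⟩ := Ideal.mem_span_singleton.1 hc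
        ext
        simp only [SetLike.val_smul, ← map_smul, ZeroMemClass.coe_zero]
        rw [Submodule.mkQ_apply, Submodule.Quotient.mk_eq_zero, smul_eq_mul]
        have : (b + z * c) * (a * u) = b * (a * u) + (z * a) * (c * u) := by ring
        rw [this]
        exact Ideal.add_mem I (Ideal.mul_mem_right _ I hb) (Ideal.mul_mem_right _ I hza)
    · refine hA ((R ⧸ I) ⧸ K) (I ⊔ Ideal.span {a}) ?_ ?_ i hi
      · rw [lt_iff_le_and_ne]
        refine ⟨le_sup_left, fun h => haI ?_⟩
        rw [h]; exact Ideal.mem_sup_right (Ideal.mem_span_singleton_self a)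
      · intro r hr x
        obtain ⟨x, rfl⟩ := Submodule.mkQ_surjective _ x
        obtain ⟨x, rfl⟩ := Submodule.mkQ_surjective _ x
        rw [← map_smul, ← map_smul, Submodule.mkQ_apply, Submodule.Quotient.mk_eq_zero]
        obtain ⟨b, hb, c, hc, rfl⟩ := Submodule.mem_sup.1 hr
        obtain ⟨c, rfl⟩ := Ideal.mem_span_singleton.1 hc
        rw [add_smul, map_add]
        have : I.mkQ (b • x) = 0 := by
          rw [Submodule.mkQ_apply, Submodule.Quotient.mk_eq_zero]
          exact Ideal.mul_mem_right _ I hb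
        rw [this, zero_add]
        refine Submodule.mem_map_of_mem ?_
        rw [smul_eq_mul, mul_assoc]
        exact Ideal.mul_mem_right _ _ (Ideal.mem_span_singleton_self a)

lemma aux_bass (N : ModuleCat.{0} R) [Module.Finite R N] (e : ℕ)
    (h : ∀ i, e < i → Subsingleton (Ext (ModuleCat.of R (R ⧸ maximalIdeal R)) N i)) :
    HasInjectiveDimensionLT N (e + 1) :=
  aux_injdim e N fun I => aux_bass_prime N e h I (e+1) (by omega)

end bass

open IsLocalRing
open CategoryTheory CategoryTheory.Abelian

set_option linter.unusedSectionVars false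

section toolkit
variable {R : Type} [CommRing R]

/-- concrete short exact sequences of modules, second form -/
lemma aux_se {A B C : Type} [AddCommGroup A] [AddCommGroup B] [AddCommGroup C]
    [Module R A] [Module R B] [Module R C] (f : A →ₗ[R] B) (g : B →ₗ[R] C)
    (hf : Function.Injective f) (hg : Function.Surjective g) (h : Function.Exact f g) :
    (ShortComplex.mk (ModuleCat.ofHom f) (ModuleCat.ofHom g)
      (ModuleCat.hom_ext h.linearMap_comp_eq_zero)).ShortExact :=
  aux_shortExact f g hf hg h

variable {A B C : ModuleCat.{0} R} {f : A ⟶ B} {g : B ⟶ C} {w : f ≫ g = 0}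

/-- the class of an extension -/
noncomputable def xi (hS : (ShortComplex.mk f g w).ShortExact) : Ext C A 1 := hS.extClass

lemma con1 (hS : (ShortComplex.mk f g w).ShortExact) {Y : ModuleCat.{0} R} {n₀ n₁ : ℕ}
    (x : Ext A Y n₀) (h : 1 + n₀ = n₁) (hx : (xi hS).comp x h = 0) :
    ∃ y : Ext B Y n₀, (Ext.mk₀ f).comp y (zero_add n₀) = x :=
  Ext.contravariant_sequence_exact₁ hS Y x h hx

lemma con2 (hS : (ShortComplex.mk f g w).ShortExact) {Y : ModuleCat.{0} R} {n : ℕ}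
    (x : Ext B Y n) (hx : (Ext.mk₀ f).comp x (zero_add n) = 0) :
    ∃ y : Ext C Y n, (Ext.mk₀ g).comp y (zero_add n) = x :=
  Ext.contravariant_sequence_exact₂ hS Y x hx

lemma con3 (hS : (ShortComplex.mk f g w).ShortExact) {Y : ModuleCat.{0} R} {n₀ n₁ : ℕ}
    (x : Ext C Y n₁) (h : 1 + n₀ = n₁) (hx : (Ext.mk₀ g).comp x (zero_add n₁) = 0) :
    ∃ y : Ext A Y n₀, (xi hS).comp y h = x :=
  Ext.contravariant_sequence_exact₃ hS Y x hx h

lemma con_f_g (hS : (ShortComplex.mk f g w).ShortExact) {Y : ModuleCat.{0} R} {n₀ n₁ : ℕ}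
    (h : 1 + n₀ = n₁) (y : Ext B Y n₀) :
    (xi hS).comp ((Ext.mk₀ f).comp y (zero_add n₀)) h = 0 :=
  ShortComplex.ShortExact.extClass_comp_assoc hS y

lemma cov1 (hS : (ShortComplex.mk f g w).ShortExact) {X : ModuleCat.{0} R} {n₀ n₁ : ℕ}
    (x : Ext X A n₁) (h : n₀ + 1 = n₁) (hx : x.comp (Ext.mk₀ f) (add_zero n₁) = 0) :
    ∃ y : Ext X C n₀, y.comp (xi hS) h = x :=
  Ext.covariant_sequence_exact₁ X hS x hx h

lemma cov2 (hS : (ShortComplex.mk f g w).ShortExact) {X : ModuleCat.{0} R} {n : ℕ}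
    (x : Ext X B n) (hx : x.comp (Ext.mk₀ g) (add_zero n) = 0) :
    ∃ y : Ext X A n, y.comp (Ext.mk₀ f) (add_zero n) = x :=
  Ext.covariant_sequence_exact₂ X hS x hx

lemma cov3 (hS : (ShortComplex.mk f g w).ShortExact) {X : ModuleCat.{0} R} {n₀ n₁ : ℕ}
    (x : Ext X C n₀) (h : n₀ + 1 = n₁) (hx : x.comp (xi hS) h = 0) :
    ∃ y : Ext X B n₀, y.comp (Ext.mk₀ g) (add_zero n₀) = x :=
  Ext.covariant_sequence_exact₃ X hS x h hx

lemma xi_nat {A' B' C' : ModuleCat.{0} R} {f' : A' ⟶ B'} {g' : B' ⟶ C'} {w' : f' ≫ g' = 0}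
    (hS : (ShortComplex.mk f g w).ShortExact) (hS' : (ShortComplex.mk f' g' w').ShortExact)
    (α : A ⟶ A') (β : B ⟶ B') (γ : C ⟶ C') (h1 : α ≫ f' = f ≫ β) (h2 : β ≫ g' = g ≫ γ) :
    (xi hS).comp (Ext.mk₀ α) (add_zero 1) = (Ext.mk₀ γ).comp (xi hS') (zero_add 1) :=
  ShortComplex.ShortExact.extClass_naturality hS hS'
    (ShortComplex.Hom.mk α β γ h1 h2)

lemma aux_iso_cov {A B : ModuleCat.{0} R} (e : A ≅ B) (N : ModuleCat.{0} R) (i : ℕ)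
    (h : Subsingleton (Ext N A i)) : Subsingleton (Ext N B i) := by
  refine subsingleton_of_forall_eq 0 fun x => ?_
  have : x = (x.comp (Ext.mk₀ e.inv) (add_zero i)).comp (Ext.mk₀ e.hom) (add_zero i) := by
    rw [Ext.comp_assoc_of_second_deg_zero, Ext.mk₀_comp_mk₀]; simp
  rw [this, Subsingleton.elim (x.comp (Ext.mk₀ e.inv) (add_zero i)) 0, Ext.zero_comp]

end toolkit

section chain
variable {R : Type} [CommRing R] [IsLocalRing R] [IsNoetherianRing R]

/-- cyclic modules -/
abbrev QQ (J : Ideal R) : ModuleCat.{0} R := ModuleCat.of R (R ⧸ J)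

/-- the ring as a module -/
abbrev RR (R : Type) [CommRing R] : ModuleCat.{0} R := ModuleCat.of R R

/-- regular sequences which stay part of a minimal system of generators -/
inductive Chain : ℕ → Ideal R → Prop
  | zero : Chain 0 ⊥
  | succ (j : ℕ) (J : Ideal R) (y : R) : Chain j J → y ∈ maximalIdeal R →
      IsSMulRegular (R ⧸ J) y → y ∉ maximalIdeal R ^ 2 ⊔ J → Chain (j+1) (J ⊔ Ideal.span {y})

/-- multiplication by `y` -/
def mulMap (J : Ideal R) (y : R) : (R ⧸ J) →ₗ[R] (R ⧸ J) := y • LinearMap.id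

/-- projection -/
def prj {J J' : Ideal R} (h : J ≤ J') : (R ⧸ J) →ₗ[R] (R ⧸ J') := Submodule.factor h

@[simp] lemma prj_mk {J J' : Ideal R} (h : J ≤ J') (a : R) :
    prj h (Submodule.Quotient.mk a) = Submodule.Quotient.mk a := rfl

lemma prj_surj {J J' : Ideal R} (h : J ≤ J') : Function.Surjective (prj h) := by
  intro x
  obtain ⟨a, rfl⟩ := Submodule.Quotient.mk_surjective _ x
  exact ⟨Submodule.Quotient.mk a, rfl⟩

lemma mulMap_mk (J : Ideal R) (y c : R) :
    mulMap J y (Submodule.Quotient.mk c) = Submodule.Quotient.mk (y * c) := rfl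

lemma chain_exact (J : Ideal R) (y : R) :
    Function.Exact (mulMap J y) (prj (le_sup_left : J ≤ J ⊔ Ideal.span {y})) := by
  intro x
  obtain ⟨a, rfl⟩ := Submodule.Quotient.mk_surjective _ x
  rw [prj_mk, Submodule.Quotient.mk_eq_zero]
  constructor
  · intro h
    obtain ⟨b, hb, c, hc, rfl⟩ := Submodule.mem_sup.1 h
    obtain ⟨c, rfl⟩ := Ideal.mem_span_singleton.1 hc
    refine ⟨Submodule.Quotient.mk c, ?_⟩
    rw [mulMap_mk, Submodule.Quotient.eq]
    have : y * c - (b + y * c) = - b := by ring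
    rw [this]; exact Submodule.neg_mem _ hb
  · rintro ⟨c, hc⟩
    obtain ⟨c, rfl⟩ := Submodule.Quotient.mk_surjective _ c
    rw [mulMap_mk, Submodule.Quotient.eq] at hc
    have : a = - (y * c - a) + y * c := by ring
    rw [this]
    exact Submodule.add_mem_sup (Submodule.neg_mem _ hc)
      (Ideal.mul_mem_right _ _ (Ideal.mem_span_singleton_self y))

lemma chain_se {J : Ideal R} {y : R} (h : IsSMulRegular (R ⧸ J) y) :
    (ShortComplex.mk (ModuleCat.ofHom (mulMap J y))
      (ModuleCat.ofHom (prj (le_sup_left : J ≤ J ⊔ Ideal.span {y})))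
      (ModuleCat.hom_ext (chain_exact J y).linearMap_comp_eq_zero)).ShortExact :=
  aux_se (mulMap J y) _ h (prj_surj _) (chain_exact J y)

lemma mulMap_comp {J : Ideal R} {y : R} {N : ModuleCat.{0} R} {i : ℕ} (x : Ext (QQ J) N i) :
    (Ext.mk₀ (ModuleCat.ofHom (mulMap J y))).comp x (zero_add i) = y • x := by
  have : ModuleCat.ofHom (mulMap J y) = y • 𝟙 (QQ J) := rfl
  rw [this, Ext.mk₀_smul, Ext.smul_comp, Ext.mk₀_id_comp]

/-- `R/0 ≅ R` -/
noncomputable def botIso (R : Type) [CommRing R] : QQ (⊥ : Ideal R) ≅ RR R :=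
  (Submodule.quotEquivOfEqBot (⊥ : Ideal R) rfl).toModuleIso

lemma chain1 (d : ℕ) (h0 : ∀ i < d, Subsingleton (Ext (QQ (maximalIdeal R)) (RR R) i))
    {j : ℕ} {J : Ideal R} (hJ : Chain j J) :
    ∀ i, i + j < d → Subsingleton (Ext (QQ (maximalIdeal R)) (QQ J) i) := by
  induction hJ with
  | zero => exact fun i hi => aux_iso_cov (botIso R).symm _ i (h0 i hi)
  | succ j J y hc hym hreg hy ih =>
    intro i hi
    refine subsingleton_of_forall_eq 0 fun x => ?_
    have h1 := ih (i+1) (by omega)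
    have h2 := ih i (by omega)
    obtain ⟨z, rfl⟩ := cov3 (chain_se hreg) x rfl (Subsingleton.elim _ _)
    rw [Subsingleton.elim z 0, Ext.zero_comp]

lemma chain2 (N : ModuleCat.{0} R) {j : ℕ} {J : Ideal R} (hJ : Chain j J) :
    ∀ i, j < i → Subsingleton (Ext (QQ J) N i) := by
  induction hJ with
  | zero =>
    intro i hi
    refine aux_iso (botIso R).symm _ i ?_
    obtain ⟨i, rfl⟩ := Nat.exists_eq_succ_of_ne_zero hi.ne'
    have : Projective (RR R) := inferInstance
    exact subsingleton_of_forall_eq 0 fun x => Ext.eq_zero_of_projective x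
  | succ j J y hc hym hreg hy ih =>
    intro i hi
    refine subsingleton_of_forall_eq 0 fun x => ?_
    obtain ⟨i, rfl⟩ := Nat.exists_eq_succ_of_ne_zero (show i ≠ 0 by omega)
    have h1 := ih (i+1) (by omega)
    have h2 := ih i (by omega)
    obtain ⟨z, rfl⟩ := con3 (chain_se hreg) x (add_comm 1 i) (Subsingleton.elim _ _)
    rw [Subsingleton.elim z 0, Ext.comp_zero]

lemma chain3 (N : ModuleCat.{0} R) [Module.Finite R N] [Nontrivial N] {j : ℕ} {J : Ideal R}
    (hJ : Chain j J) : ¬ Subsingleton (Ext (QQ J) N j) := by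
  induction hJ with
  | zero =>
    intro h
    have h := aux_iso (botIso R) N 0 h
    obtain ⟨x, hx⟩ := exists_ne (0 : N)
    apply hx
    have h1 : ModuleCat.ofHom (LinearMap.toSpanSingleton R N x) = 0 :=
      (Ext.mk₀_bijective (RR R) N).1 (Subsingleton.elim _ _)
    have h2 := congrArg (fun t => t.hom (1 : R)) h1
    simpa using! h2
  | succ j J y hc hym hreg hy ih =>
    intro h
    apply ih
    have hN : (⊤ : Submodule R (Ext (QQ J) N j)) = ⊥ := by
      have hfin : Module.Finite R (Ext (QQ J) N j) := inferInstance
      refine Submodule.eq_bot_of_le_smul_of_le_jacobson_bot (maximalIdeal R) _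
        hfin.1 ?_ (maximalIdeal_le_jacobson _)
      intro x _
      obtain ⟨z, rfl⟩ := con1 (chain_se hreg) x (add_comm 1 j) (Subsingleton.elim _ _)
      rw [mulMap_comp]
      exact Submodule.smul_mem_smul hym trivial
    rw [← Submodule.subsingleton_iff R, ← subsingleton_iff_bot_eq_top]
    exact hN.symm

/-- an ideal cutting down `y` -/
lemma cut_exists (J : Ideal R) (hJ : J ≤ maximalIdeal R) (y : R)
    (hy : y ∉ maximalIdeal R ^ 2 ⊔ J) : ∃ K : Ideal R, maximalIdeal R ^ 2 ≤ K ∧ J ≤ K ∧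
      K ≤ maximalIdeal R ∧ y ∉ K ∧ ∀ z ∈ maximalIdeal R, ∃ c : R, z - c * y ∈ K := by
  obtain ⟨K, ⟨hK1, hK2, hK3⟩, hmax⟩ := set_has_maximal_iff_noetherian.2
    (inferInstance : IsNoetherian R R)
    {K : Ideal R | maximalIdeal R ^ 2 ⊔ J ≤ K ∧ K ≤ maximalIdeal R ∧ y ∉ K}
    ⟨maximalIdeal R ^ 2 ⊔ J, le_rfl, sup_le (Ideal.pow_le_self two_ne_zero) hJ, hy⟩
  refine ⟨K, le_sup_left.trans hK1, le_sup_right.trans hK1, hK2, hK3, fun z hz => ?_⟩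
  by_cases hzK : z ∈ K
  · exact ⟨0, by simpa using hzK⟩
  have hyK : y ∈ K ⊔ Ideal.span {z} := by
    by_contra hcon
    refine hmax (K ⊔ Ideal.span {z}) ⟨hK1.trans le_sup_left, sup_le hK2 ?_, hcon⟩ ?_
    · rwa [Ideal.span_singleton_le_iff_mem]
    · refine lt_of_le_of_ne le_sup_left fun h => hzK ?_
      rw [h]; exact Ideal.mem_sup_right (Ideal.mem_span_singleton_self z)
  obtain ⟨b, hb, c, hc, hbc⟩ := Submodule.mem_sup.1 hyK
  obtain ⟨c, rfl⟩ := Ideal.mem_span_singleton.1 hc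
  by_cases hcm : c ∈ maximalIdeal R
  · exfalso
    apply hK3
    rw [← hbc]
    refine K.add_mem hb (hK1 (Ideal.mem_sup_left ?_))
    rw [pow_two]; exact Ideal.mul_mem_mul hz hcm
  · have hu : IsUnit c := by simpa using hcm
    obtain ⟨v, hv⟩ := hu.exists_left_inv
    refine ⟨v, ?_⟩
    have : z - v * y = - (v * b) := by
      rw [← hbc]; linear_combination - z * hv
    rw [this]
    exact K.neg_mem (Ideal.mul_mem_left K _ hb)

lemma chain_le {j : ℕ} {J : Ideal R} (hJ : Chain j J) : J ≤ maximalIdeal R := by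
  induction hJ with
  | zero => exact bot_le
  | succ j J y hc hym hreg hy ih =>
    exact sup_le ih (by rwa [Ideal.span_singleton_le_iff_mem])

lemma chain4 {j : ℕ} {J : Ideal R} (hJ : Chain j J) :
    ∃ κ : Ext (QQ J) (RR R) j,
      (∀ (N : ModuleCat.{0} R) (e : Ext (QQ J) N j),
        ∃ ρ : RR R ⟶ N, e = κ.comp (Ext.mk₀ ρ) (add_zero j)) ∧
      ∃ θ : Ext (QQ (maximalIdeal R)) (QQ (maximalIdeal R)) j,
        κ.comp (Ext.mk₀ (ModuleCat.ofHom (maximalIdeal R).mkQ)) (add_zero j) =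
          (Ext.mk₀ (ModuleCat.ofHom (prj (chain_le hJ)))).comp θ (zero_add j) := by
  induction hJ with
  | zero =>
    refine ⟨Ext.mk₀ (botIso R).hom, fun N e => ?_, Ext.mk₀ (𝟙 _), ?_⟩
    · obtain ⟨u, rfl⟩ := (Ext.mk₀_bijective _ _).2 e
      refine ⟨(botIso R).inv ≫ u, ?_⟩
      rw [Ext.mk₀_comp_mk₀]; simp
    · rw [Ext.mk₀_comp_mk₀, Ext.mk₀_comp_mk₀]
      congr 1
      refine ModuleCat.hom_ext (LinearMap.ext fun x => ?_)
      obtain ⟨c, rfl⟩ := Submodule.Quotient.mk_surjective _ x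
      rfl
  | succ j J y hc hym hreg hy ih =>
    obtain ⟨κ, hκ, θ, hθ⟩ := ih
    obtain ⟨K, hK1, hK2, hK3, hyK, hK⟩ := cut_exists J (chain_le hc) y hy
    let a : (R ⧸ maximalIdeal R) →ₗ[R] (R ⧸ K) :=
      (maximalIdeal R).liftQ (LinearMap.toSpanSingleton R (R ⧸ K) (Submodule.Quotient.mk y)) (by
        intro z hz
        rw [LinearMap.mem_ker, LinearMap.toSpanSingleton_apply, ← Submodule.Quotient.mk_smul,
          Submodule.Quotient.mk_eq_zero]
        apply hK1
        rw [pow_two]; exact Ideal.mul_mem_mul hz hym)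
    have ha : ∀ c : R, a (Submodule.Quotient.mk c) = Submodule.Quotient.mk (c * y) := by
      intro c
      rfl
    have hinj : Function.Injective a := by
      rw [injective_iff_map_eq_zero]
      intro x hx
      obtain ⟨c, rfl⟩ := Submodule.Quotient.mk_surjective _ x
      rw [ha, Submodule.Quotient.mk_eq_zero] at hx
      rw [Submodule.Quotient.mk_eq_zero]
      by_contra hcm
      have hu : IsUnit c := by simpa using hcm
      obtain ⟨v, hv⟩ := hu.exists_left_inv
      apply hyK
      have : y = v * (c * y) := by rw [← mul_assoc, hv, one_mul]
      rw [this]; exact K.mul_mem_left _ hx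
    have hex : Function.Exact a (prj hK3) := by
      intro x
      obtain ⟨c, rfl⟩ := Submodule.Quotient.mk_surjective _ x
      rw [prj_mk, Submodule.Quotient.mk_eq_zero]
      constructor
      · intro h
        obtain ⟨b, hb⟩ := hK c h
        refine ⟨Submodule.Quotient.mk b, ?_⟩
        rw [ha, eq_comm, Submodule.Quotient.eq]; exact hb
      · rintro ⟨b, hb⟩
        obtain ⟨b, rfl⟩ := Submodule.Quotient.mk_surjective _ b
        rw [ha, eq_comm, Submodule.Quotient.eq] at hb
        have : c = (c - b * y) + b * y := by ring
        rw [this]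
        exact Ideal.add_mem _ (hK3 hb) (Ideal.mul_mem_left _ _ hym)
    have hT := aux_se a (prj hK3) hinj (prj_surj _) hex
    have hnat := xi_nat (chain_se hreg) hT (ModuleCat.ofHom (prj (chain_le hc)))
      (ModuleCat.ofHom (prj hK2))
      (ModuleCat.ofHom (prj (chain_le (Chain.succ j J y hc hym hreg hy)))) (by
        refine ModuleCat.hom_ext (LinearMap.ext fun x => ?_)
        obtain ⟨c, rfl⟩ := Submodule.Quotient.mk_surjective _ x
        change a (Submodule.Quotient.mk c) = prj hK2 (mulMap J y (Submodule.Quotient.mk c))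
        rw [mulMap_mk, ha, prj_mk, mul_comm]) (by
        refine ModuleCat.hom_ext (LinearMap.ext fun x => ?_)
        obtain ⟨c, rfl⟩ := Submodule.Quotient.mk_surjective _ x
        rfl)
    refine ⟨(xi (chain_se hreg)).comp κ (add_comm 1 j), fun N e => ?_,
      (xi hT).comp θ (add_comm 1 j), ?_⟩
    · have := chain2 N hc (j+1) (by omega)
      obtain ⟨e', rfl⟩ := con3 (chain_se hreg) e (add_comm 1 j) (Subsingleton.elim _ _)
      obtain ⟨ρ, rfl⟩ := hκ N e'
      refine ⟨ρ, ?_⟩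
      rw [Ext.comp_assoc_of_third_deg_zero]
    · rw [Ext.comp_assoc_of_third_deg_zero, hθ, ← Ext.comp_assoc_of_second_deg_zero, hnat]
      apply Ext.comp_assoc
      omega

end chain

open IsLocalRing
open CategoryTheory CategoryTheory.Abelian

set_option linter.unusedSectionVars false
open scoped Pointwise

section chain'
variable {R : Type} [CommRing R] [IsLocalRing R] [IsNoetherianRing R]

lemma chain5 {j : ℕ} {J : Ideal R} (hJ : Chain j J) :
    Module.supportDim R (R ⧸ J) + (j : ℕ) = ringKrullDim R := by
  induction hJ with
  | zero =>
    rw [Module.supportDim_eq_of_equiv (Submodule.quotEquivOfEqBot (⊥ : Ideal R) rfl),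
      Module.supportDim_self_eq_ringKrullDim]
    simp
  | succ j J y hc hym hreg hy ih =>
    have hr : LinearMap.range (mulMap J y) = y • (⊤ : Submodule R (R ⧸ J)) := by
      ext x
      constructor
      · rintro ⟨z, rfl⟩
        exact Submodule.smul_mem_pointwise_smul z y ⊤ trivial
      · intro hx
        obtain ⟨z, -, rfl⟩ := Submodule.mem_smul_pointwise_iff_exists _ _ _ |>.1 hx
        exact ⟨z, rfl⟩
    have e : QuotSMulTop y (R ⧸ J) ≃ₗ[R] R ⧸ (J ⊔ Ideal.span {y}) :=
      (Submodule.quotEquivOfEq _ _ hr.symm).trans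
        ((chain_exact J y).linearEquivOfSurjective (prj_surj _))
    have h := Module.supportDim_quotSMulTop_succ_eq_supportDim hreg hym
    rw [Module.supportDim_eq_of_equiv e] at h
    rw [← ih, ← h, Nat.cast_add, Nat.cast_one, add_assoc, add_comm (j : WithBot ℕ∞) 1]

lemma chain6 {j : ℕ} {J : Ideal R} (hJ : Chain j J) :
    ∃ x : Fin j → R, Ideal.span (Set.range x) = J := by
  induction hJ with
  | zero => exact ⟨Fin.elim0, by simp⟩
  | succ j J y hc hym hreg hy ih =>
    obtain ⟨x, rfl⟩ := ih
    refine ⟨Fin.cons y x, ?_⟩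
    rw [Fin.range_cons, Ideal.span_insert, sup_comm]

lemma chain6' {d : ℕ} (x : Fin d → R) (hx : Ideal.span (Set.range x) = maximalIdeal R)
    {j : ℕ} {J : Ideal R} (hJ : Chain j J) :
    ∃ s : Finset R, s.card + j ≤ d ∧ J ⊔ Ideal.span (s : Set R) = maximalIdeal R := by
  classical
  induction hJ with
  | zero =>
    refine ⟨Finset.univ.image x, ?_, ?_⟩
    · simpa using (Finset.card_image_le (s := Finset.univ) (f := x))
    · simp [hx]
  | succ j J y hc hym hreg hy ih =>
    obtain ⟨s, hs, hsm⟩ := ih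
    have hy' := hym
    rw [← hsm] at hy'
    obtain ⟨a, ha, b, hb, rfl⟩ := Submodule.mem_sup.1 hy'
    obtain ⟨c, -, rfl⟩ := Submodule.mem_span_finset.1 hb
    have hsub : ∀ z ∈ s, z ∈ maximalIdeal R := fun z hz => by
      rw [← hsm]; exact Ideal.mem_sup_right (Ideal.subset_span hz)
    have : ∃ z ∈ s, c z ∉ maximalIdeal R := by
      by_contra! hcon
      apply hy
      rw [sup_comm]
      refine Submodule.add_mem_sup ha (Ideal.sum_mem _ fun z hz => ?_)
      rw [pow_two]
      exact Ideal.mul_mem_mul (hcon z hz) (hsub z hz)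
    obtain ⟨z, hz, hcz⟩ := this
    refine ⟨s.erase z, ?_, ?_⟩
    · have := Finset.card_erase_add_one hz
      omega
    set y := a + ∑ z ∈ s, c z • z with hydef
    have hzmem : z ∈ J ⊔ Ideal.span {y} ⊔ Ideal.span ((s.erase z : Finset R) : Set R) := by
      have hu : IsUnit (c z) := by simpa using hcz
      obtain ⟨v, hv⟩ := hu.exists_left_inv
      have h1 : y = a + (c z * z + ∑ w ∈ s.erase z, c w * w) := by
        rw [hydef, ← Finset.add_sum_erase s _ hz]; rfl
      have h2 : z = - (v * a) + v * y + - (v * ∑ w ∈ s.erase z, c w * w) := by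
        rw [h1]; linear_combination - z * hv
      suffices hz' : - (v * a) + v * y + - (v * ∑ w ∈ s.erase z, c w * w) ∈
          J ⊔ Ideal.span {y} ⊔ Ideal.span ((s.erase z : Finset R) : Set R) by
        rw [← h2] at hz'; exact hz'
      refine Submodule.add_mem_sup (Submodule.add_mem_sup ?_ ?_) ?_
      · exact Ideal.neg_mem_iff _ |>.2 (Ideal.mul_mem_left _ _ ha)
      · exact Ideal.mul_mem_left _ _ (Ideal.mem_span_singleton_self y)
      · refine Ideal.neg_mem_iff _ |>.2 (Ideal.mul_mem_left _ _ (Ideal.sum_mem _ fun w hw => ?_))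
        exact Ideal.mul_mem_left _ _ (Ideal.subset_span hw)
    apply le_antisymm
    · refine sup_le (sup_le ((le_sup_left.trans hsm.le)) ?_) ?_
      · rwa [Ideal.span_singleton_le_iff_mem]
      · rw [Ideal.span_le]
        intro w hw
        exact hsub w (Finset.mem_of_mem_erase hw)
    · rw [← hsm]
      refine sup_le (le_sup_left.trans le_sup_left) ?_
      rw [Ideal.span_le]
      intro w hw
      by_cases hwz : w = z
      · subst hwz; exact hzmem
      · exact Ideal.mem_sup_right (Ideal.subset_span (Finset.mem_erase.2 ⟨hwz, hw⟩))

lemma chain_regular {d : ℕ} {J : Ideal R} (hJ : Chain d J) (hdim : ringKrullDim R = d) :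
    IsRegularLocal R ↔ J = maximalIdeal R := by
  constructor
  · rintro ⟨n, x, hx, hn⟩
    have : n = d := by rw [hdim] at hn; exact_mod_cast hn.symm
    subst this
    obtain ⟨s, hs, h⟩ := chain6' x hx hJ
    have : s = ∅ := by rw [← Finset.card_eq_zero]; omega
    subst this
    simpa using h
  · rintro rfl
    obtain ⟨x, hx⟩ := chain6 hJ
    exact ⟨d, x, hx, hdim⟩

lemma chain_succ_exists (d : ℕ)
    (h0 : ∀ i < d, Subsingleton (Ext (QQ (maximalIdeal R)) (RR R) i))
    {j : ℕ} {J : Ideal R} (hJ : Chain j J) (hj : j < d) : ∃ J' : Ideal R, Chain (j+1) J' := by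
  have hsub := chain1 d h0 hJ 0 (by omega)
  have hnoinj : ∀ u : (R ⧸ maximalIdeal R) →ₗ[R] (R ⧸ J), ¬ Function.Injective u := by
    intro u hu
    have h1 : ModuleCat.ofHom u = 0 := (Ext.mk₀_bijective (QQ (maximalIdeal R)) (QQ J)).1
      (Subsingleton.elim _ _)
    have h2 : u = 0 := congrArg ModuleCat.Hom.hom h1
    subst h2
    obtain ⟨x, hx⟩ := exists_ne (0 : R ⧸ maximalIdeal R)
    exact hx (hu rfl)
  have hnotass : maximalIdeal R ∉ associatedPrimes R (R ⧸ J) := by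
    intro h
    obtain ⟨-, u, hu⟩ := (isAssociatedPrime_iff_exists_injective_linearMap _ _).1 h
    exact hnoinj u hu
  by_contra hcon
  have hfin := (associatedPrimes.finite R (R ⧸ J)).insert (maximalIdeal R ^ 2 ⊔ J)
  have hsubset : (maximalIdeal R : Set R) ⊆
      ⋃ p ∈ insert (maximalIdeal R ^ 2 ⊔ J) (associatedPrimes R (R ⧸ J)), ((id p : Ideal R) : Set R) := by
    intro y hy
    by_contra hy2
    apply hcon
    rw [Set.biUnion_insert, Set.mem_union, not_or] at hy2
    refine ⟨_, Chain.succ j J y hJ hy ?_ hy2.1⟩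
    have := hy2.2
    simp only [id] at this
    rw [biUnion_associatedPrimes_eq_compl_regular, Set.notMem_compl_iff] at this
    exact this
  obtain ⟨p, hp, hle⟩ := (Ideal.subset_union_prime_finite hfin (f := id)
    (maximalIdeal R ^ 2 ⊔ J) (maximalIdeal R ^ 2 ⊔ J) (by
      intro p hp hne _
      rcases hp with hp | hp
      · exact absurd hp hne
      · exact IsAssociatedPrime.isPrime hp)).1 hsubset
  rcases hp with rfl | hp
  · have hmJ : maximalIdeal R ≤ J := by
      refine Submodule.le_of_le_smul_of_le_jacobson_bot (I := maximalIdeal R)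
        (IsNoetherian.noetherian _) (maximalIdeal_le_jacobson _) ?_
      rw [smul_eq_mul, ← pow_two, sup_comm]
      exact hle
    have : J = maximalIdeal R := le_antisymm (chain_le hJ) hmJ
    subst this
    exact hnoinj LinearMap.id (fun _ _ h => h)
  · have hpp : p.IsPrime := IsAssociatedPrime.isPrime hp
    have : p = maximalIdeal R := le_antisymm (le_maximalIdeal hpp.ne_top) hle
    subst this
    exact hnotass hp

lemma chain_exists (d : ℕ)
    (h0 : ∀ i < d, Subsingleton (Ext (QQ (maximalIdeal R)) (RR R) i)) :
    ∀ j, j ≤ d → ∃ J : Ideal R, Chain j J := by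
  intro j
  induction j with
  | zero => exact fun _ => ⟨⊥, Chain.zero⟩
  | succ j ih =>
    intro hj
    obtain ⟨J, hJ⟩ := ih (by omega)
    exact chain_succ_exists d h0 hJ (by omega)

lemma chain8 {d : ℕ} {J : Ideal R} (hJ : Chain d J) (hdim : ringKrullDim R = d)
    (hne : J ≠ maximalIdeal R) : ∃ σ : (R ⧸ maximalIdeal R) →ₗ[R] (R ⧸ J),
      Function.Injective σ ∧ (prj (chain_le hJ)) ∘ₗ σ = 0 := by
  have h5 := chain5 hJ
  rw [hdim] at h5
  have hJtop : J ≠ ⊤ := fun h => by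
    have := chain_le hJ
    rw [h] at this
    exact (maximalIdeal.isMaximal R).ne_top (top_le_iff.1 this)
  have hnt : Nontrivial (R ⧸ J) := Ideal.Quotient.nontrivial_iff.2 hJtop
  have hzero : Module.supportDim R (R ⧸ J) = 0 := by
    have hb := Module.supportDim_ne_bot_of_nontrivial R (R ⧸ J)
    generalize Module.supportDim R (R ⧸ J) = a at *
    induction a using WithBot.recBotCoe with
    | bot => exact absurd rfl hb
    | coe a =>
      have : a + (d : ℕ∞) = d := by exact_mod_cast h5
      have : a = 0 := by
        induction a using ENat.recTopCoe with
        | top => simp at this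
        | coe a => norm_cast at this ⊢; omega
      rw [this]; rfl
  have hsupp := support_of_supportDim_eq_zero R (R ⧸ J) hzero
  obtain ⟨p, hp⟩ := associatedPrimes.nonempty R (R ⧸ J)
  obtain ⟨hpp, u, hu⟩ := (isAssociatedPrime_iff_exists_injective_linearMap _ _).1 hp
  have hJp : J ≤ p := by
    intro r hr
    have : u (r • Submodule.Quotient.mk 1) = 0 := by
      rw [map_smul]
      obtain ⟨a, ha⟩ := Submodule.Quotient.mk_surjective _ (u (Submodule.Quotient.mk 1))
      rw [← ha, ← Submodule.Quotient.mk_smul, Submodule.Quotient.mk_eq_zero]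
      exact Ideal.mul_mem_right _ _ hr
    rw [← map_zero u] at this
    have := hu this
    rw [← Submodule.Quotient.mk_smul, Submodule.Quotient.mk_eq_zero] at this
    simpa using this
  have hpm : p = maximalIdeal R := by
    have h1 : (⟨p, hpp⟩ : PrimeSpectrum R) ∈ Module.support R (R ⧸ J) := by
      rw [Module.mem_support_iff_of_finite, Ideal.annihilator_quotient]
      exact hJp
    rw [hsupp, PrimeSpectrum.mem_zeroLocus] at h1
    exact le_antisymm (le_maximalIdeal hpp.ne_top) h1
  subst hpm
  refine ⟨u, hu, ?_⟩
  obtain ⟨a, ha⟩ := Submodule.Quotient.mk_surjective _ (u (Submodule.Quotient.mk 1))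
  have hall : ∀ c : R, u (Submodule.Quotient.mk c) = Submodule.Quotient.mk (c * a) := by
    intro c
    have : (Submodule.Quotient.mk c : R ⧸ maximalIdeal R) = c • Submodule.Quotient.mk 1 := by
      rw [← Submodule.Quotient.mk_smul]; simp
    rw [this, map_smul, ← ha]; rfl
  have ham : a ∈ maximalIdeal R := by
    by_contra hcon
    have hua : IsUnit a := by simpa using hcon
    obtain ⟨v, hv⟩ := hua.exists_right_inv
    apply hne
    refine le_antisymm hJp fun r hr => ?_
    have h1 : (Submodule.Quotient.mk r : R ⧸ maximalIdeal R) = 0 :=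
      (Submodule.Quotient.mk_eq_zero _).2 hr
    have h2 := hall r
    rw [h1, map_zero, eq_comm, Submodule.Quotient.mk_eq_zero] at h2
    have : r = r * a * v := by rw [mul_assoc, hv, mul_one]
    rw [this]; exact Ideal.mul_mem_right _ _ h2
  refine LinearMap.ext fun x => ?_
  obtain ⟨c, rfl⟩ := Submodule.Quotient.mk_surjective _ x
  rw [LinearMap.comp_apply, hall, prj_mk, LinearMap.zero_apply, Submodule.Quotient.mk_eq_zero]
  exact Ideal.mul_mem_left _ _ ham

lemma chain_base {d : ℕ} (hCM : depthGE R R d) :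
    ∀ i < d, Subsingleton (Ext (QQ (maximalIdeal R)) (RR R) i) := by
  obtain ⟨rs, rfl, hmem, hreg⟩ := hCM
  refine ModuleCat.subsingleton_ext_of_exists_isRegular (maximalIdeal R) (QQ (maximalIdeal R)) ?_
    (RR R) ?_ rs hmem hreg
  · have := Module.support_eq_zeroLocus (R := R) (M := R ⧸ maximalIdeal R)
    rw [Ideal.annihilator_quotient] at this
    exact this.le
  · rw [lt_top_iff_ne_top]
    intro h
    have h2 : (maximalIdeal R • ⊤ : Submodule R R) = ⊤ := h
    rw [smul_eq_mul, Ideal.mul_top] at h2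
    exact (maximalIdeal.isMaximal R).ne_top h2

end chain'

open IsLocalRing
open CategoryTheory CategoryTheory.Abelian

set_option linter.unusedSectionVars false

section mulemmas

/-- linear algebra over a field -/
lemma finrank_iff_inj {K A B C : Type} [Field K] [AddCommGroup A] [AddCommGroup B]
    [AddCommGroup C] [Module K A] [Module K B] [Module K C] [Module.Finite K A]
    [Module.Finite K B] [Module.Finite K C] (f : A →ₗ[K] B) (g : B →ₗ[K] C)
    (hg : Function.Surjective g) (h : Function.Exact f g) :
    Module.finrank K B = Module.finrank K A + Module.finrank K C ↔ Function.Injective f := by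
  have h1 := LinearMap.finrank_range_add_finrank_ker f
  have h2 := LinearMap.finrank_range_add_finrank_ker g
  rw [LinearMap.exact_iff.1 h, LinearMap.range_eq_top.2 hg, finrank_top] at h2
  rw [← LinearMap.ker_eq_bot, ← Submodule.finrank_eq_zero (R := K)]
  omega

variable {R : Type} [CommRing R] [IsLocalRing R] [IsNoetherianRing R]

lemma exists_functional {M : Type} [AddCommGroup M] [Module R M] (x : M)
    (hx : x ∉ (maximalIdeal R • ⊤ : Submodule R M)) :
    ∃ π : M →ₗ[R] R ⧸ maximalIdeal R, π x = 1 := by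
  letI : Field (R ⧸ maximalIdeal R) := Ideal.Quotient.field _
  obtain ⟨φ, hφ⟩ := Module.Projective.exists_dual_eq_one (R ⧸ maximalIdeal R)
    (x := (Submodule.Quotient.mk x : M ⧸ (maximalIdeal R • ⊤ : Submodule R M)))
    (by rwa [Ne, Submodule.Quotient.mk_eq_zero])
  exact ⟨(φ.restrictScalars R) ∘ₗ Submodule.mkQ _, hφ⟩

variable {N X S : Type} [AddCommGroup N] [AddCommGroup X] [AddCommGroup S]
  [Module R N] [Module R X] [Module R S] [Module.Finite R N] [Module.Finite R X]
  [Module.Finite R S]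

lemma mu_add_iff (f : N →ₗ[R] X) (g : X →ₗ[R] S) (hg : Function.Surjective g)
    (h : Function.Exact f g) :
    mu R X = mu R N + mu R S ↔ ∀ n : N, f n ∈ (maximalIdeal R • ⊤ : Submodule R X) →
      n ∈ (maximalIdeal R • ⊤ : Submodule R N) := by
  letI : Field (R ⧸ maximalIdeal R) := Ideal.Quotient.field _
  have hf' : (maximalIdeal R • ⊤ : Submodule R N) ≤
      (maximalIdeal R • ⊤ : Submodule R X).comap f := by
    rw [← Submodule.map_le_iff_le_comap, Submodule.map_smul'']
    exact Submodule.smul_mono le_rfl le_top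
  have hg' : (maximalIdeal R • ⊤ : Submodule R X) ≤
      (maximalIdeal R • ⊤ : Submodule R S).comap g := by
    rw [← Submodule.map_le_iff_le_comap, Submodule.map_smul'']
    exact Submodule.smul_mono le_rfl le_top
  let F := LinearMap.extendScalarsOfSurjective (S := R ⧸ maximalIdeal R)
    Ideal.Quotient.mk_surjective (Submodule.mapQ _ _ f hf')
  let G := LinearMap.extendScalarsOfSurjective (S := R ⧸ maximalIdeal R)
    Ideal.Quotient.mk_surjective (Submodule.mapQ _ _ g hg')
  have hF : ∀ n : N, F (Submodule.Quotient.mk n) = Submodule.Quotient.mk (f n) := fun n => rfl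
  have hG : ∀ n : X, G (Submodule.Quotient.mk n) = Submodule.Quotient.mk (g n) := fun n => rfl
  have hGs : Function.Surjective G := by
    intro x
    obtain ⟨x, rfl⟩ := Submodule.Quotient.mk_surjective _ x
    obtain ⟨x, rfl⟩ := hg x
    exact ⟨_, hG x⟩
  have hex : Function.Exact F G := by
    intro x
    obtain ⟨x, rfl⟩ := Submodule.Quotient.mk_surjective _ x
    rw [hG, Submodule.Quotient.mk_eq_zero]
    constructor
    · intro hx
      have : g x ∈ (maximalIdeal R • ⊤ : Submodule R X).map g := by
        rw [Submodule.map_smul'', Submodule.map_top, LinearMap.range_eq_top.2 hg]; exact hx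
      obtain ⟨x', hx', hxx⟩ := this
      have : g (x - x') = 0 := by rw [map_sub, hxx, sub_self]
      obtain ⟨n, hn⟩ := (h _).1 this
      refine ⟨Submodule.Quotient.mk n, ?_⟩
      rw [hF, Submodule.Quotient.eq, hn]
      have : x - x' - x = - x' := by abel
      rw [this]; exact Submodule.neg_mem _ hx'
    · rintro ⟨n, hn⟩
      obtain ⟨n, rfl⟩ := Submodule.Quotient.mk_surjective _ n
      rw [hF, Submodule.Quotient.eq] at hn
      have h1 : g x = - g (f n - x) := by rw [map_sub, h.apply_apply_eq_zero]; simp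
      rw [h1]; exact Submodule.neg_mem _ (hg' hn)
  have hfin : ∀ (M : Type) [AddCommGroup M] [Module R M] [Module.Finite R M],
      Module.Finite (R ⧸ maximalIdeal R) (M ⧸ (maximalIdeal R • ⊤ : Submodule R M)) := by
    intro M _ _ _
    exact Module.Finite.of_restrictScalars_finite R _ _
  have := hfin N
  have := hfin X
  have := hfin S
  refine (finrank_iff_inj F G hGs hex).trans ?_
  rw [injective_iff_map_eq_zero]
  constructor
  · intro hi n hn
    have := hi (Submodule.Quotient.mk n) (by rw [hF, Submodule.Quotient.mk_eq_zero]; exact hn)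
    rwa [Submodule.Quotient.mk_eq_zero] at this
  · intro hi n hn
    obtain ⟨n, rfl⟩ := Submodule.Quotient.mk_surjective _ n
    rw [hF, Submodule.Quotient.mk_eq_zero] at hn
    rw [Submodule.Quotient.mk_eq_zero]; exact hi n hn

lemma kill_max {M : Type} [AddCommGroup M] [Module R M] (π : M →ₗ[R] R ⧸ maximalIdeal R) (x : M)
    (hx : x ∈ (maximalIdeal R • ⊤ : Submodule R M)) : π x = 0 := by
  have : (maximalIdeal R • ⊤ : Submodule R M) ≤ LinearMap.ker π := by
    rw [Submodule.smul_le]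
    intro r hr n _
    rw [LinearMap.mem_ker, map_smul]
    obtain ⟨a, ha⟩ := Submodule.Quotient.mk_surjective _ (π n)
    rw [← ha, ← Submodule.Quotient.mk_smul, Submodule.Quotient.mk_eq_zero]
    exact Ideal.mul_mem_right _ _ hr
  exact this hx

lemma mu_add_of_extend (f : N →ₗ[R] X) (g : X →ₗ[R] S) (hg : Function.Surjective g)
    (h : Function.Exact f g)
    (hext : ∀ π : N →ₗ[R] R ⧸ maximalIdeal R, ∃ π' : X →ₗ[R] R ⧸ maximalIdeal R, π' ∘ₗ f = π) :
    mu R X = mu R N + mu R S := by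
  rw [mu_add_iff f g hg h]
  intro n hn
  by_contra hcon
  obtain ⟨π, hπ⟩ := exists_functional n hcon
  obtain ⟨π', rfl⟩ := hext π
  rw [LinearMap.comp_apply, kill_max π' _ hn] at hπ
  exact zero_ne_one hπ

lemma split_of_mu_add (f : (R ⧸ maximalIdeal R) →ₗ[R] X) (g : X →ₗ[R] S)
    (hf : Function.Injective f) (hg : Function.Surjective g)
    (h : Function.Exact f g) (hmu : mu R X = mu R (R ⧸ maximalIdeal R) + mu R S) :
    ∃ s : S →ₗ[R] X, g ∘ₗ s = LinearMap.id := by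
  rw [mu_add_iff f g hg h] at hmu
  have h1 : f 1 ∉ (maximalIdeal R • ⊤ : Submodule R X) := by
    intro hcon
    have := kill_max LinearMap.id _ (hmu 1 hcon)
    exact one_ne_zero this
  obtain ⟨r, hr⟩ := exists_functional _ h1
  refine ((h.split_tfae hf hg).out 0 1 rfl rfl).2 ⟨r, ?_⟩
  refine LinearMap.ext fun x => ?_
  obtain ⟨c, rfl⟩ := Ideal.Quotient.mk_surjective x
  have : Ideal.Quotient.mk (maximalIdeal R) c = c • (1 : R ⧸ maximalIdeal R) := by
    rw [Algebra.smul_def, mul_one]; rfl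
  rw [this, map_smul, map_smul, LinearMap.comp_apply, hr, LinearMap.id_apply]

end mulemmas

section injdim
variable {R : Type} [CommRing R]

lemma injdim_of_res (n : ℕ) : ∀ (N : Type) [AddCommGroup N] [Module R N]
    (I : ℕ → ModuleCat.{0} R) (f : ∀ j : ℕ, (I j →ₗ[R] I (j+1))) (ι : N →ₗ[R] I 0),
    (∀ j, Module.Injective R (I j)) → Function.Injective ι → Function.Exact ι (f 0) →
    (∀ j, Function.Exact (f j) (f (j+1))) → (∀ j, n ≤ j → Subsingleton (I j)) →
    HasInjectiveDimensionLT (ModuleCat.of R N) (n + 1) := by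
  induction n with
  | zero =>
    intro N _ _ I f ι hI hι hex hex' hs
    have := hs 0 le_rfl
    have : Subsingleton N := hι.subsingleton
    have : Limits.IsZero (ModuleCat.of R N) := ModuleCat.isZero_of_subsingleton _
    have := this.hasInjectiveDimensionLT_zero
    exact hasInjectiveDimensionLT_of_ge _ 0 _ (by omega)
  | succ n ih =>
    intro N _ _ I f ι hI hι hex hex' hs
    have h3 := ih (LinearMap.range (f 0)) (fun j => I (j+1)) (fun j => f (j+1))
      (Submodule.subtype _) (fun j => hI _) (Submodule.injective_subtype _) (by
        intro x
        rw [hex' 0 x]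
        simp) (fun j => hex' _) (fun j hj => hs _ (by omega))
    have hS := aux_se ι (f 0).rangeRestrict hι (LinearMap.surjective_rangeRestrict _) (by
      intro x
      rw [← hex x]
      simp [Subtype.ext_iff])
    have hi : Injective (ModuleCat.of R (I 0)) := (Module.injective_iff_injective_object R (I 0)).1 (hI 0)
    exact (hS.hasInjectiveDimensionLT_X₃_iff n hi).1 h3

lemma injdim_of_finite {N : Type} [AddCommGroup N] [Module R N] (h : HasFiniteInjDim R N) :
    ∃ n, HasInjectiveDimensionLT (ModuleCat.of R N) n := by
  obtain ⟨n, I, f, ι, h1, h2, h3, h4, h5⟩ := h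
  exact ⟨_, injdim_of_res (n+1) N I f ι h1 h2 h3 h4 (fun j hj => h5 j (by omega))⟩

lemma finite_of_injdim (n : ℕ) : ∀ (N : ModuleCat.{0} R), HasInjectiveDimensionLT N (n + 1) →
    HasFiniteInjDim R N := by
  induction n with
  | zero =>
    intro N h
    have hN : Injective N := injective_iff_hasInjectiveDimensionLT_one.2 h
    have hN' : Module.Injective R N := (Module.injective_iff_injective_object R N).2 hN
    refine ⟨0, fun j => Nat.casesOn j N (fun _ => ModuleCat.of R PUnit), fun j => 0,
      LinearMap.id, ?_, fun _ _ h => h, ?_, ?_, ?_⟩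
    · rintro (_ | j)
      · exact hN'
      · exact ⟨fun X Y _ _ _ _ f hf g => ⟨0, fun x => Subsingleton.elim (α := PUnit) _ _⟩⟩
    · intro x
      exact ⟨fun _ => ⟨x, rfl⟩, fun _ => rfl⟩
    · intro j x
      exact ⟨fun _ => ⟨0, Subsingleton.elim (α := PUnit) _ _⟩,
        fun _ => Subsingleton.elim (α := PUnit) _ _⟩
    · rintro (_ | j) hj
      · omega
      · exact inferInstanceAs (Subsingleton PUnit)
  | succ n ih =>
    intro N h
    obtain ⟨S, hS, rfl, hi⟩ := aux_cosyz N
    rw [← hS.hasInjectiveDimensionLT_X₃_iff n hi] at h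
    obtain ⟨m, I, f, ι, h1, h2, h3, h4, h5⟩ := ih _ h
    have hf : Function.Injective S.f := (ModuleCat.mono_iff_injective _).1 hS.mono_f
    have hg : Function.Surjective S.g := (ModuleCat.epi_iff_surjective _).1 hS.epi_g
    have hex : Function.Exact S.f S.g := (ShortComplex.ShortExact.moduleCat_exact_iff_function_exact S).1 hS.exact
    have hi' : Module.Injective R S.X₂ := (Module.injective_iff_injective_object R _).2 hi
    refine ⟨m + 1, fun j => Nat.casesOn j S.X₂ I,
      fun j => match j with
        | 0 => ι ∘ₗ S.g.hom
        | j+1 => f j, S.f.hom, ?_, hf, ?_, ?_, ?_⟩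
    · rintro (_ | j)
      · exact hi'
      · exact h1 j
    · intro x
      rw [← hex x]
      change ι (S.g x) = 0 ↔ S.g x = 0
      rw [← map_zero ι, h2.eq_iff]
    · rintro (_ | j)
      · intro x
        refine (h3 x).trans ?_
        constructor
        · rintro ⟨y, rfl⟩
          obtain ⟨z, rfl⟩ := hg y
          exact ⟨z, rfl⟩
        · rintro ⟨z, rfl⟩
          exact ⟨S.g z, rfl⟩
      · exact h4 j
    · rintro (_ | j) hj
      · omega
      · exact h5 j (by omega)

end injdim

section shift
variable {R : Type} [CommRing R] [IsLocalRing R] [IsNoetherianRing R]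

/-- dimension shifting -/
def Shift (i : ℕ) (S : ModuleCat.{0} R) : Prop :=
  ∃ τ : Ext (QQ (maximalIdeal R)) S i, ∀ (Y : ModuleCat.{0} R) (n m : ℕ) (h : i + n = m), 1 ≤ n →
    (∀ e : Ext S Y n, τ.comp e h = 0 → e = 0) ∧
    (∀ x : Ext (QQ (maximalIdeal R)) Y m, ∃ e : Ext S Y n, τ.comp e h = x)

lemma shift_zero : Shift 0 (QQ (maximalIdeal R)) := by
  refine ⟨Ext.mk₀ (𝟙 _), fun Y n m h hn => ?_⟩
  obtain rfl : n = m := by omega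
  refine ⟨fun e he => ?_, fun x => ⟨x, Ext.mk₀_id_comp x⟩⟩
  rwa [Ext.mk₀_id_comp] at he

lemma shift_iso {i : ℕ} {S S' : ModuleCat.{0} R} (e : S ≅ S') (hS : Shift i S) : Shift i S' := by
  obtain ⟨τ, hτ⟩ := hS
  refine ⟨τ.comp (Ext.mk₀ e.hom) (add_zero i), fun Y n m h hn => ⟨fun x hx => ?_, fun x => ?_⟩⟩
  · rw [Ext.comp_assoc_of_second_deg_zero] at hx
    have := (hτ Y n m h hn).1 _ hx
    have h2 : x = (Ext.mk₀ e.inv).comp ((Ext.mk₀ e.hom).comp x (zero_add n)) (zero_add n) := by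
      rw [Ext.mk₀_comp_mk₀_assoc]; simp
    rw [h2, this, Ext.comp_zero]
  · obtain ⟨y, rfl⟩ := (hτ Y n m h hn).2 x
    refine ⟨(Ext.mk₀ e.inv).comp y (zero_add n), ?_⟩
    rw [Ext.comp_assoc_of_second_deg_zero, Ext.mk₀_comp_mk₀_assoc]; simp

lemma shift_succ {i : ℕ} {A B C : ModuleCat.{0} R} {f : A ⟶ B} {g : B ⟶ C} {w : f ≫ g = 0}
    (hS : (ShortComplex.mk f g w).ShortExact) (hB : Projective B) (hC : Shift i C) :
    Shift (i + 1) A := by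
  obtain ⟨τ, hτ⟩ := hC
  refine ⟨τ.comp (xi hS) rfl, fun Y n m h hn => ?_⟩
  have hass : ∀ e : Ext A Y n, (τ.comp (xi hS) rfl).comp e h =
      τ.comp ((xi hS).comp e rfl) (by omega) := fun e => by
    apply Ext.comp_assoc
    omega
  have hB0 : ∀ k (_ : 1 ≤ k) (e : Ext B Y k), e = 0 := by
    intro k hk e
    obtain ⟨k, rfl⟩ := Nat.exists_eq_succ_of_ne_zero (show k ≠ 0 by omega)
    exact Ext.eq_zero_of_projective e
  obtain ⟨h1, h2⟩ := hτ Y (1 + n) m (by omega) (by omega)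
  refine ⟨fun e he => ?_, fun x => ?_⟩
  · rw [hass] at he
    obtain ⟨y, rfl⟩ := con1 hS e rfl (h1 _ he)
    rw [hB0 n hn y, Ext.comp_zero]
  · obtain ⟨z, rfl⟩ := h2 x
    obtain ⟨y, rfl⟩ := con3 hS z rfl (hB0 _ (by omega) _)
    exact ⟨y, hass y⟩

lemma shift_syzygy {i : ℕ} {S : Type} [AddCommGroup S] [Module R S]
    (h : IsMinSyzygyOfResidueField R i S) : Shift i (ModuleCat.of R S) := by
  obtain ⟨b, f, ε, hε, h0, hex, -, -, h⟩ := h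
  have hr : ∀ j, Shift (j+1) (ModuleCat.of R (LinearMap.range (f j))) := by
    intro j
    induction j with
    | zero =>
      refine shift_succ (aux_se (LinearMap.range (f 0)).subtype ε (Submodule.injective_subtype _) hε ?_)
        ?_ shift_zero
      · intro x
        rw [h0 x]; simp
      · infer_instance
    | succ j ih =>
      refine shift_succ (aux_se (LinearMap.range (f (j+1))).subtype (f j).rangeRestrict
        (Submodule.injective_subtype _) (LinearMap.surjective_rangeRestrict _) ?_)
        ?_ ih
      · intro x
        rw [Subtype.ext_iff]
        change f j x = 0 ↔ _
        rw [hex j x]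
        simp
      · infer_instance
  rcases h with ⟨rfl, ⟨e⟩⟩ | ⟨j, rfl, ⟨e⟩⟩
  · exact shift_iso e.symm.toModuleIso shift_zero
  · exact shift_iso e.symm.toModuleIso (hr j)

end shift

open IsLocalRing
open CategoryTheory CategoryTheory.Abelian

set_option linter.unusedSectionVars false

section final
variable {R : Type} [CommRing R] [IsLocalRing R] [IsNoetherianRing R]

/-- concrete pushout of an extension -/
lemma pushout_ext {W F S N : Type} [AddCommGroup W] [AddCommGroup F] [AddCommGroup S]
    [AddCommGroup N] [Module R W] [Module R F] [Module R S] [Module R N]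
    [Module.Finite R F] [Module.Finite R N] (ι : W →ₗ[R] F) (p : F →ₗ[R] S)
    (hι : Function.Injective ι) (hp : Function.Surjective p) (hex : Function.Exact ι p)
    (φ : W →ₗ[R] N) :
    ∃ (X : ModuleCat.{0} R) (_ : Module.Finite R X) (f : N →ₗ[R] X) (g : X →ₗ[R] S)
      (β : F →ₗ[R] X), Function.Injective f ∧ Function.Surjective g ∧ Function.Exact f g ∧
      f ∘ₗ φ = β ∘ₗ ι ∧ g ∘ₗ β = p := by
  let K : Submodule R (N × F) := LinearMap.range (φ.prod (-ι))
  have hK : K ≤ LinearMap.ker (p ∘ₗ LinearMap.snd R N F) := by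
    rintro _ ⟨w, rfl⟩
    simp [hex.apply_apply_eq_zero w]
  refine ⟨ModuleCat.of R ((N × F) ⧸ K), inferInstanceAs (Module.Finite R ((N × F) ⧸ K)),
    K.mkQ ∘ₗ LinearMap.inl R N F,
    K.liftQ (p ∘ₗ LinearMap.snd R N F) hK, K.mkQ ∘ₗ LinearMap.inr R N F, ?_, ?_, ?_, ?_, ?_⟩
  · rw [← LinearMap.ker_eq_bot, LinearMap.ker_eq_bot']
    intro n hn
    have hn' : ((n, 0) : N × F) ∈ K := (Submodule.Quotient.mk_eq_zero K).1 hn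
    obtain ⟨w, hw⟩ := hn'
    have h1 : φ w = n := congrArg Prod.fst hw
    have h2 : - ι w = 0 := congrArg Prod.snd hw
    have h3 : w = 0 := hι (by rw [map_zero]; exact neg_eq_zero.1 h2)
    rw [← h1, h3, map_zero]
  · intro s
    obtain ⟨y, rfl⟩ := hp s
    exact ⟨K.mkQ (0, y), rfl⟩
  · intro x
    obtain ⟨⟨n, y⟩, rfl⟩ := Submodule.Quotient.mk_surjective K x
    constructor
    · intro h
      have h' : p y = 0 := h
      obtain ⟨w, rfl⟩ := (hex y).1 h'
      refine ⟨n + φ w, ?_⟩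
      change Submodule.Quotient.mk (n + φ w, (0 : F)) = _
      rw [Submodule.Quotient.eq]
      exact ⟨w, by ext <;> simp⟩
    · rintro ⟨n', hn'⟩
      rw [← hn']
      change p 0 = 0
      exact map_zero p
  · ext w
    change (Submodule.Quotient.mk (φ w, (0 : F)) : (N × F) ⧸ K) =
      Submodule.Quotient.mk ((0 : N), ι w)
    rw [Submodule.Quotient.eq]
    exact ⟨w, by ext <;> simp⟩
  · ext y
    rfl

/-- vanishing of classes that die under all maps to the residue field -/
lemma realize (N : ModuleCat.{0} R) [Module.Finite R N] (S : Type) [AddCommGroup S] [Module R S]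
    [Module.Finite R S]
    (hsplit : ∀ (X : Type) [AddCommGroup X] [Module R X] [Module.Finite R X]
          (f : ↥N →ₗ[R] X) (g : X →ₗ[R] S),
          Function.Injective f → Function.Surjective g → Function.Exact f g →
          mu R X = mu R ↥N + mu R S →
          ∃ s : S →ₗ[R] X, g ∘ₗ s = LinearMap.id)
    (e : Ext (ModuleCat.of R S) N 1)
    (he : ∀ π : N ⟶ QQ (maximalIdeal R), e.comp (Ext.mk₀ π) (add_zero 1) = 0) : e = 0 := by
  obtain ⟨b, p, hp⟩ := Module.Finite.exists_fin' R S
  have hex0 : Function.Exact (LinearMap.ker p).subtype p := fun x => by simp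
  have hse := aux_se (LinearMap.ker p).subtype p (Submodule.injective_subtype _) hp hex0
  have hproj : Projective (ModuleCat.of R (Fin b → R)) := inferInstance
  obtain ⟨φ0, hφ0⟩ := con3 hse e (add_zero 1) (Ext.eq_zero_of_projective _)
  obtain ⟨φ, rfl⟩ := (Ext.mk₀_bijective _ _).2 φ0
  obtain ⟨X, hX, f, g, β, hf, hg, hfg, h1, h2⟩ := pushout_ext (LinearMap.ker p).subtype p
    (Submodule.injective_subtype _) hp hex0 φ.hom
  have hse2 := aux_se f g hf hg hfg
  have hxi : xi hse2 = e := by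
    have := xi_nat hse hse2 φ (ModuleCat.ofHom β) (𝟙 _)
      (ModuleCat.hom_ext h1) (by rw [Category.comp_id]; exact ModuleCat.hom_ext h2)
    rw [Ext.mk₀_id_comp] at this
    rw [← this]; exact hφ0
  have hmu : mu R X = mu R N + mu R S := by
    refine mu_add_of_extend f g hg hfg fun π => ?_
    have h3 := he (ModuleCat.ofHom π)
    rw [← hxi] at h3
    obtain ⟨y, hy⟩ := con1 hse2 _ _ h3
    obtain ⟨y, rfl⟩ := (Ext.mk₀_bijective _ _).2 y
    rw [Ext.mk₀_comp_mk₀] at hy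
    have hy' := (Ext.mk₀_bijective _ _).1 hy
    exact ⟨y.hom, congrArg ModuleCat.Hom.hom hy'⟩
  obtain ⟨s, hs⟩ := hsplit X f g hf hg hfg hmu
  have h4 : (Ext.mk₀ (ModuleCat.ofHom g)).comp (xi hse2) (zero_add 1) = 0 :=
    ShortComplex.ShortExact.comp_extClass hse2
  have h5 : ModuleCat.ofHom s ≫ ModuleCat.ofHom g = 𝟙 (ModuleCat.of R S) :=
    ModuleCat.hom_ext hs
  rw [← hxi, ← Ext.mk₀_id_comp (xi hse2), ← h5, ← Ext.mk₀_comp_mk₀,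
    Ext.comp_assoc_of_second_deg_zero, h4, Ext.comp_zero]

/-- a map from `R` to the residue field factors through the residue field -/
lemma factor_res (ψ : RR R ⟶ QQ (maximalIdeal R)) :
    ∃ c : QQ (maximalIdeal R) ⟶ QQ (maximalIdeal R),
      ψ = ModuleCat.ofHom (maximalIdeal R).mkQ ≫ c := by
  have h : maximalIdeal R ≤ LinearMap.ker ψ.hom := by
    intro x hx
    rw [LinearMap.mem_ker]
    have h1 : ψ.hom x = x • ψ.hom (1 : R) := by
      rw [← map_smul]; simp
    rw [h1]
    obtain ⟨a, ha⟩ := Submodule.Quotient.mk_surjective _ (ψ.hom (1 : R))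
    rw [← ha, ← Submodule.Quotient.mk_smul, Submodule.Quotient.mk_eq_zero]
    exact Ideal.mul_mem_right _ _ hx
  exact ⟨ModuleCat.ofHom ((maximalIdeal R).liftQ ψ.hom h), by
    ext; rfl⟩

lemma drop_injdim {d : ℕ} {J : Ideal R} (hJ : Chain d J)
    (σ : (R ⧸ maximalIdeal R) →ₗ[R] (R ⧸ J)) (hσ : Function.Injective σ)
    (N : ModuleCat.{0} R) [Module.Finite R N] (t : ℕ)
    (h : HasInjectiveDimensionLT N (d + 1 + t)) : HasInjectiveDimensionLT N (d + 1) := by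
  induction t with
  | zero => exact h
  | succ t ih =>
    refine ih ?_
    have := aux_bass N (d + t) fun i hi => subsingleton_of_forall_eq 0 fun x => by
      have hse := aux_se σ (LinearMap.range σ).mkQ hσ (Submodule.mkQ_surjective _)
        (LinearMap.exact_map_mkQ_range σ)
      obtain ⟨y, hy⟩ := con1 hse x rfl
        (Ext.eq_zero_of_hasInjectiveDimensionLT _ (d + 1 + (t + 1)) (by omega))
      have := chain2 N hJ i (by omega)
      rw [← hy, Subsingleton.elim y 0, Ext.comp_zero]
    have h6 : d + t + 1 = d + 1 + t := by omega
    rwa [h6] at this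

end final

/-- Let `(R,𝔪,k)` be a Cohen–Macaulay Noetherian local ring of dimension `d ≥ 1`.
Then `R` is regular iff there is a finitely generated nonzero module `N` of finite injective
dimension such that `Ext¹_R(Ω^{d-1} k, N)^μ = 0`, i.e. every `μ`-additive short exact sequence
`0 → N → X → Ω^{d-1} k → 0` of finitely generated modules splits. -/
theorem stmt0 (R : Type) [CommRing R] [IsLocalRing R] [IsNoetherianRing R]
    (d : ℕ) (hd : 1 ≤ d) (hdim : ringKrullDim R = d) (hCM : depthGE R R d)
    (S : Type) [AddCommGroup S] [Module R S] [Module.Finite R S]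
    (hS : IsMinSyzygyOfResidueField R (d - 1) S) :
    IsRegularLocal R ↔
      ∃ N : ModuleCat.{0} R, Module.Finite R ↥N ∧ Nontrivial ↥N ∧ HasFiniteInjDim R ↥N ∧
        ∀ (X : Type) [AddCommGroup X] [Module R X] [Module.Finite R X]
          (f : ↥N →ₗ[R] X) (g : X →ₗ[R] S),
          Function.Injective f → Function.Surjective g → Function.Exact f g →
          mu R X = mu R ↥N + mu R S →
          ∃ s : S →ₗ[R] X, g ∘ₗ s = LinearMap.id := by
  obtain ⟨J, hJ⟩ := chain_exists d (chain_base hCM) d le_rfl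
  constructor
  · intro hreg
    have hJm := (chain_regular hJ hdim).1 hreg
    subst hJm
    refine ⟨QQ (maximalIdeal R), inferInstanceAs (Module.Finite R (R ⧸ maximalIdeal R)),
      inferInstanceAs (Nontrivial (R ⧸ maximalIdeal R)), ?_, ?_⟩
    · have : Module.Finite R (QQ (maximalIdeal R)) :=
        inferInstanceAs (Module.Finite R (R ⧸ maximalIdeal R))
      exact finite_of_injdim d _ (aux_bass (QQ (maximalIdeal R)) d fun i hi => chain2 _ hJ i hi)
    · intro X _ _ _ f g hf hg hfg hmu
      exact split_of_mu_add f g hf hg hfg hmu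
  · rintro ⟨N, hfin, hnt, hinj, hsplit⟩
    rw [chain_regular hJ hdim]
    by_contra hne
    obtain ⟨σ, hσ, hprj⟩ := chain8 hJ hdim hne
    obtain ⟨n, hn⟩ := injdim_of_finite hinj
    have hn' : HasInjectiveDimensionLT N n := hn
    have hN : HasInjectiveDimensionLT N (d + 1) :=
      drop_injdim hJ σ hσ N n (hasInjectiveDimensionLT_of_ge N n _ (by omega))
    have hkN : ¬ Subsingleton (Ext (QQ (maximalIdeal R)) N d) := by
      intro hsub
      have h1 := aux_bass N (d - 1) fun i hi => by
        rcases Nat.lt_or_ge d i with h | h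
        · exact subsingleton_of_forall_eq 0 fun x =>
            Ext.eq_zero_of_hasInjectiveDimensionLT x (d + 1) h
        · have : i = d := by omega
          subst this
          exact hsub
      exact chain3 N hJ (subsingleton_of_forall_eq 0 fun x =>
        Ext.eq_zero_of_hasInjectiveDimensionLT x (d - 1 + 1) (by omega))
    have hse := aux_se σ (LinearMap.range σ).mkQ hσ (Submodule.mkQ_surjective _)
      (LinearMap.exact_map_mkQ_range σ)
    obtain ⟨τ, hτ⟩ := shift_syzygy hS
    have hd1 : d - 1 + 1 = d := by omega
    obtain ⟨κ, hκ, θ, hθ⟩ := chain4 hJ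
    obtain ⟨l, hl⟩ := (hτ (RR R) 1 d hd1 le_rfl).2
      ((Ext.mk₀ (ModuleCat.ofHom σ)).comp κ (zero_add d))
    have hlε : l.comp (Ext.mk₀ (ModuleCat.ofHom (maximalIdeal R).mkQ)) (add_zero 1) = 0 := by
      refine (hτ _ 1 d hd1 le_rfl).1 _ ?_
      rw [← Ext.comp_assoc_of_third_deg_zero, hl, Ext.comp_assoc_of_third_deg_zero, hθ,
        Ext.mk₀_comp_mk₀_assoc]
      have h0 : ModuleCat.ofHom σ ≫ ModuleCat.ofHom (prj (chain_le hJ)) = 0 :=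
        ModuleCat.hom_ext hprj
      rw [h0, Ext.mk₀_zero, Ext.zero_comp]
    have hext : ∀ e : Ext (ModuleCat.of R S) N 1, e = 0 := by
      intro e
      refine realize N S hsplit e fun π => ?_
      obtain ⟨e', he'⟩ := con1 hse (τ.comp e hd1) rfl
        (Ext.eq_zero_of_hasInjectiveDimensionLT _ (d + 1) (by omega))
      obtain ⟨ρ, rfl⟩ := hκ N e'
      have he : e = l.comp (Ext.mk₀ ρ) (add_zero 1) := by
        rw [← sub_eq_zero]
        refine (hτ _ 1 d hd1 le_rfl).1 _ ?_
        rw [sub_eq_add_neg, Ext.comp_add, Ext.comp_neg, ← he', ← Ext.comp_assoc_of_third_deg_zero, ←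
          Ext.comp_assoc_of_third_deg_zero, hl, add_neg_cancel]
      obtain ⟨c, hc⟩ := factor_res (ρ ≫ π)
      rw [he, Ext.comp_assoc_of_third_deg_zero, Ext.mk₀_comp_mk₀, hc, ← Ext.mk₀_comp_mk₀,
        ← Ext.comp_assoc_of_third_deg_zero, hlε, Ext.zero_comp]
    refine hkN (subsingleton_of_forall_eq 0 fun x => ?_)
    obtain ⟨e, rfl⟩ := (hτ N 1 d hd1 le_rfl).2 x
    rw [hext e, Ext.comp_zero]
end

section
/- Let (R,m,k) be a Cohen–Macaulay Noetherian local ring of dimension d that has minimal multiplicity, i.e., there is a system of parameters x_1, …, x_d of R with m² = (x_1,…,x_d)m. Then for every maximal Cohen–Macaulay R-module M and every finitely generated free R-module F, every short exact sequence 0 → F → X → M → 0 of finitely generated R-modules is μ-additive, i.e., μ(X) = μ(F) + μ(M). Equivalently, Ext^1_R(M,F)^μ = Ext^1_R(M,F). -/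
open IsLocalRing

section Aux
open IsLocalRing RingTheory.Sequence Pointwise CategoryTheory Abelian Limits
open Module (supportDim)

/-- dimension upper bound -/
lemma aux_dim_le {R : Type} [CommRing R] [IsLocalRing R] [IsNoetherianRing R] (k : ℕ)
    (xs : List R) (hxs : ∀ r ∈ xs, r ∈ maximalIdeal R) :
    ∀ (N : Type) [AddCommGroup N] [Module R N] [Module.Finite R N],
      maximalIdeal R ^ k ≤ Module.annihilator R N ⊔ Ideal.ofList xs →
      supportDim R N ≤ xs.length := by
  induction xs with
  | nil =>
    intro N _ _ _ h
    have : Subsingleton (Module.support R N) := by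
      constructor
      have key : ∀ p ∈ Module.support R N, p.asIdeal = maximalIdeal R := by
        intro p hp
        rw [Module.support_eq_zeroLocus] at hp
        have h1 : maximalIdeal R ^ k ≤ p.asIdeal := by
          refine h.trans ?_
          rw [Ideal.ofList_nil, sup_bot_eq]
          exact hp
        have h2 := Ideal.IsPrime.le_of_pow_le h1
        exact le_antisymm (IsLocalRing.le_maximalIdeal p.isPrime.ne_top) h2
      rintro ⟨a, ha⟩ ⟨b, hb⟩
      exact Subtype.ext (PrimeSpectrum.ext ((key a ha).trans (key b hb).symm))
    simpa using! Order.krullDim_nonpos_of_subsingleton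
  | cons x xs ih =>
    intro N _ _ _ h
    simp only [List.mem_cons, forall_eq_or_imp] at hxs
    have h1 := Module.supportDim_le_supportDim_quotSMulTop_succ (M := N) hxs.1
    have h2 := ih hxs.2 (QuotSMulTop x N) (by
      refine h.trans ?_
      rw [Ideal.ofList_cons, ← sup_assoc]
      refine sup_le_sup_right (sup_le ?_ ?_) _
      · exact LinearMap.annihilator_le_of_surjective (Submodule.mkQ _) (Submodule.mkQ_surjective _)
      · rw [Ideal.span_singleton_le_iff_mem, Module.mem_annihilator]
        intro m
        obtain ⟨m, rfl⟩ := Submodule.mkQ_surjective _ m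
        rw [← map_smul, Submodule.mkQ_apply, Submodule.Quotient.mk_eq_zero]
        exact Submodule.smul_mem_pointwise_smul _ _ _ trivial)
    refine h1.trans ?_
    push_cast [List.length_cons]
    gcongr

lemma aux_le_dim {R : Type} [CommRing R] [IsLocalRing R] [IsNoetherianRing R]
    (rs : List R) (hrs : ∀ r ∈ rs, r ∈ maximalIdeal R) :
    ∀ (M : Type) [AddCommGroup M] [Module R M] [Module.Finite R M],
      IsWeaklyRegular M rs → ∀ p ∈ associatedPrimes R M,
      (rs.length : WithBot ℕ∞) ≤ supportDim R (R ⧸ p) := by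
  induction rs with
  | nil =>
    intro M _ _ _ h p hp
    have : p.IsPrime := hp.isPrime
    have : Nontrivial (R ⧸ p) := Ideal.Quotient.nontrivial_iff.mpr this.ne_top
    have h := Module.supportDim_ne_bot_of_nontrivial R (R ⧸ p)
    have : Nonempty (Module.support R (R ⧸ p)) := 
      Set.Nonempty.to_subtype (Module.nonempty_support_iff.mpr inferInstance)
    simpa using! Order.krullDim_nonneg
  | cons y rs ih =>
    intro M _ _ _ h p hp
    simp only [List.mem_cons, forall_eq_or_imp] at hrs
    rw [isWeaklyRegular_cons_iff] at h
    have hp' : p.IsPrime := hp.isPrime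
    obtain ⟨_, u0, hu0⟩ := isAssociatedPrime_iff.mp hp
    have hyp : y ∉ p := by
      intro hy
      have : y ∈ ⋃ p ∈ associatedPrimes R M, (p : Set R) := by
        simp only [Set.mem_iUnion]; exact ⟨p, hp, hy⟩
      rw [biUnion_associatedPrimes_eq_compl_regular] at this
      exact this h.1
    let L : Submodule R M := 
      { carrier := {u | ∀ a ∈ p, a • u = 0}
        add_mem' := by intro a b ha hb c hc; rw [smul_add, ha c hc, hb c hc, add_zero]
        zero_mem' := by intro c _; simp
        smul_mem' := by intro c u hu a ha; rw [smul_comm, hu a ha, smul_zero] }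
    have hu0L : u0 ∈ L := by
      intro a ha
      rw [hu0] at ha
      simpa [Submodule.mem_colon_singleton] using ha
    have hu0ne : u0 ≠ 0 := by
      rintro rfl
      apply hp'.ne_top
      rw [hu0, Ideal.eq_top_iff_one]
      simp [Submodule.mem_colon_singleton]
    obtain ⟨u, huL, huy⟩ : ∃ u ∈ L, u ∉ y • (⊤ : Submodule R M) := by
      by_contra! hcon
      have : L ≤ (maximalIdeal R) • L := by
        intro u hu
        obtain ⟨v, -, rfl⟩ := (Submodule.mem_smul_pointwise_iff_exists _ _ _).mp (hcon u hu)
        refine Submodule.smul_mem_smul hrs.1 ?_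
        intro a ha
        apply h.1
        have := hu a ha
        simpa [smul_comm y a] using this
      have hL := Submodule.eq_bot_of_le_smul_of_le_jacobson_bot _ L (IsNoetherian.noetherian L) this
        (maximalIdeal_le_jacobson _)
      rw [hL] at hu0L
      exact hu0ne (by simpa using hu0L)
    obtain ⟨q, hq, hle⟩ := exists_le_isAssociatedPrime_of_isNoetherianRing (R := R)
      (Submodule.Quotient.mk u : QuotSMulTop y M) (by
        rwa [ne_eq, Submodule.Quotient.mk_eq_zero])
    have hpq : p ≤ q := by
      intro a ha
      apply hle
      rw [Submodule.mem_colon_singleton, ← Submodule.Quotient.mk_smul, huL a ha]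
      simp
    have hyq : y ∈ q := by
      apply hle
      rw [Submodule.mem_colon_singleton, ← Submodule.Quotient.mk_smul, Submodule.mem_bot,
        Submodule.Quotient.mk_eq_zero]
      exact Submodule.smul_mem_pointwise_smul _ _ _ trivial
    have h1 := ih hrs.2 (QuotSMulTop y M) h.2 q hq
    have hreg : IsSMulRegular (R ⧸ p) y := by
      rw [isSMulRegular_quotient_iff_mem_of_smul_mem]
      intro a ha
      exact (hp'.mem_or_mem ha).resolve_left hyp
    have h2 := Module.supportDim_quotSMulTop_succ_eq_supportDim hreg hrs.1
    rw [← h2]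
    have h3 : supportDim R (R ⧸ q) ≤ supportDim R (QuotSMulTop y (R ⧸ p)) := by
      refine Module.supportDim_le_of_surjective (Submodule.liftQ _ (Submodule.factor hpq) ?_) ?_
      · intro z hz
        obtain ⟨v, -, rfl⟩ := (Submodule.mem_smul_pointwise_iff_exists _ _ _).mp hz
        obtain ⟨v, rfl⟩ := Submodule.mkQ_surjective _ v
        rw [LinearMap.mem_ker, ← map_smul]
        exact (Submodule.Quotient.mk_eq_zero q).mpr (q.mul_mem_right _ hyq)
      · intro z
        obtain ⟨v, rfl⟩ := Submodule.mkQ_surjective _ z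
        exact ⟨Submodule.Quotient.mk (Submodule.Quotient.mk v), rfl⟩
    push_cast [List.length_cons]
    gcongr
    exact h1.trans h3

lemma aux_depth_quot {R : Type} [CommRing R] [IsLocalRing R] [IsNoetherianRing R]
    (n : ℕ) (M : Type) [AddCommGroup M] [Module R M] [Module.Finite R M] (x : R)
    (hxm : x ∈ maximalIdeal R) (hx : IsSMulRegular M x)
    (h : ∃ rs : List R, rs.length = n + 1 ∧ (∀ r ∈ rs, r ∈ maximalIdeal R) ∧ IsRegular M rs) :
    ∃ rs : List R, rs.length = n ∧ (∀ r ∈ rs, r ∈ maximalIdeal R) ∧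
      IsRegular (QuotSMulTop x M) rs := by
  obtain ⟨rs, hlen, hmem, hreg⟩ := h
  have : Nontrivial M := hreg.nontrivial
  have : Nontrivial (QuotSMulTop x M) := nontrivial_quotSMulTop_of_mem_maximalIdeal M hxm
  have lt (M : Type) [AddCommGroup M] [Module R M] [Module.Finite R M] [Nontrivial M] :
      maximalIdeal R • (⊤ : Submodule R M) < ⊤ :=
    (Submodule.top_ne_ideal_smul_of_le_jacobson_annihilator
      (maximalIdeal_le_jacobson _)).symm.lt_top
  let N := ModuleCat.of R (R ⧸ maximalIdeal R)
  have suppN : Module.support R N = PrimeSpectrum.zeroLocus (maximalIdeal R) := by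
    rw [Module.support_eq_zeroLocus]
    exact congrArg (fun I : Ideal R => PrimeSpectrum.zeroLocus (I : Set R))
      (Ideal.annihilator_quotient (I := maximalIdeal R))
  have fN : Module.Finite R N := inferInstanceAs (Module.Finite R (R ⧸ maximalIdeal R))
  have hE := ModuleCat.subsingleton_ext_of_exists_isRegular (maximalIdeal R) N suppN.subset
    (ModuleCat.of R M) (lt M) rs hmem hreg
  refine ModuleCat.exists_isRegular_of_exists_subsingleton_ext (maximalIdeal R) n
    (ModuleCat.of R (QuotSMulTop x M)) (lt _) N suppN ?_
  intro i hi
  have zero1 := AddCommGrpCat.isZero_of_iff_subsingleton.mpr (hE i (by omega))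
  have zero2 := AddCommGrpCat.isZero_of_iff_subsingleton.mpr (hE (i + 1) (by omega))
  have hx' : IsSMulRegular (ModuleCat.of R M) x := hx
  exact AddCommGrpCat.subsingleton_of_isZero <| ShortComplex.Exact.isZero_of_both_zeros
    ((Ext.covariant_sequence_exact₃' N hx'.smulShortComplex_shortExact) i (i + 1) rfl)
    (zero1.eq_zero_of_src _) (zero2.eq_zero_of_tgt _)

lemma aux_sop {R : Type} [CommRing R] [IsLocalRing R] [IsNoetherianRing R] (k : ℕ)
    (xs : List R) (hxs : ∀ r ∈ xs, r ∈ maximalIdeal R) :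
    ∀ (M : Type) [AddCommGroup M] [Module R M] [Module.Finite R M],
      maximalIdeal R ^ k ≤ Module.annihilator R M ⊔ Ideal.ofList xs →
      (∃ rs : List R, rs.length = xs.length ∧ (∀ r ∈ rs, r ∈ maximalIdeal R) ∧ IsRegular M rs) →
      IsWeaklyRegular M xs := by
  induction xs with
  | nil => intros; exact IsWeaklyRegular.nil _ _
  | cons x xs ih =>
    intro M _ _ _ h hd
    simp only [List.mem_cons, forall_eq_or_imp] at hxs
    have hx : IsSMulRegular M x := by
      by_contra hx
      have : x ∈ ⋃ p ∈ associatedPrimes R M, (p : Set R) := by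
        rw [biUnion_associatedPrimes_eq_compl_regular]; exact hx
      simp only [Set.mem_iUnion] at this
      obtain ⟨p, hp, hxp⟩ := this
      obtain ⟨rs, hlen, hmem, hreg⟩ := hd
      have h1 := aux_le_dim rs hmem M hreg.1 p hp
      have h2 := aux_dim_le k xs hxs.2 (R ⧸ p) (by
        refine h.trans ?_
        rw [Ideal.ofList_cons, ← sup_assoc, Ideal.annihilator_quotient]
        refine sup_le_sup_right (sup_le ?_ ?_) _
        · rw [← Submodule.annihilator_top]; exact hp.annihilator_le
        · rw [Ideal.span_singleton_le_iff_mem]; exact hxp)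
      have h3 := h1.trans h2
      rw [hlen, List.length_cons] at h3
      have h4 : xs.length + 1 ≤ xs.length := by exact_mod_cast h3
      omega
    refine IsWeaklyRegular.cons hx (ih hxs.2 _ ?_ (aux_depth_quot _ M x hxs.1 hx hd))
    refine h.trans ?_
    rw [Ideal.ofList_cons, ← sup_assoc]
    refine sup_le_sup_right (sup_le ?_ ?_) _
    · exact LinearMap.annihilator_le_of_surjective (Submodule.mkQ _) (Submodule.mkQ_surjective _)
    · rw [Ideal.span_singleton_le_iff_mem, Module.mem_annihilator]
      intro m
      obtain ⟨m, rfl⟩ := Submodule.mkQ_surjective _ m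
      rw [← map_smul, Submodule.mkQ_apply, Submodule.Quotient.mk_eq_zero]
      exact Submodule.smul_mem_pointwise_smul _ _ _ trivial

lemma aux_inj {R : Type} [CommRing R] (xs : List R)
    {F X M : Type} [AddCommGroup F] [Module R F] [AddCommGroup X] [Module R X]
    [AddCommGroup M] [Module R M] (f : F →ₗ[R] X) (g : X →ₗ[R] M)
    (hf : Function.Injective f) (hg : Function.Surjective g) (hfg : Function.Exact f g)
    (h : IsWeaklyRegular M xs) (u : F) (hu : f u ∈ Ideal.ofList xs • (⊤ : Submodule R X)) :
    u ∈ Ideal.ofList xs • (⊤ : Submodule R F) := by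
  have h0 : Function.Exact (0 : PUnit →ₗ[R] F) f := by
    intro z
    constructor
    · intro hz; exact ⟨0, by simpa using (hf (hz.trans (map_zero f).symm)).symm⟩
    · rintro ⟨_, rfl⟩; simp
  have := map_first_exact_on_four_term_right_exact_of_isSMulRegular_last h0 hfg hg h
  obtain ⟨z, hz⟩ := (this (Submodule.Quotient.mk u)).mp (by
    rw [Submodule.mapQ_apply, Submodule.Quotient.mk_eq_zero]; exact hu)
  obtain ⟨z, rfl⟩ := Submodule.mkQ_surjective _ z
  rw [Submodule.mkQ_apply, Submodule.mapQ_apply] at hz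
  rw [← Submodule.Quotient.mk_eq_zero, ← hz]
  simp

lemma aux_coord {R : Type} [CommRing R] (I : Ideal R) {F : Type} [AddCommGroup F] [Module R F]
    {ι : Type} (b : Module.Basis ι R F) (u : F) :
    u ∈ I • (⊤ : Submodule R F) ↔ ∀ i, b.repr u i ∈ I := by
  constructor
  · intro hu i
    have : b.coord i u ∈ (I • (⊤ : Submodule R F)).map (b.coord i) := ⟨u, hu, rfl⟩
    rw [Submodule.map_smul''] at this
    have h2 := (Submodule.smul_mono (le_refl I) le_top) this
    simpa using h2
  · intro h
    rw [← b.linearCombination_repr u, Finsupp.linearCombination_apply]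
    exact Submodule.sum_mem _ fun i _ => Submodule.smul_mem_smul (h i) trivial

lemma aux_mu {R : Type} [CommRing R] [IsLocalRing R] [IsNoetherianRing R]
    {F X M : Type} [AddCommGroup F] [Module R F] [Module.Finite R F]
    [AddCommGroup X] [Module R X] [Module.Finite R X]
    [AddCommGroup M] [Module R M] [Module.Finite R M] (f : F →ₗ[R] X) (g : X →ₗ[R] M)
    (hg : Function.Surjective g) (hfg : Function.Exact f g)
    (h : ∀ u, f u ∈ maximalIdeal R • (⊤ : Submodule R X) →
      u ∈ maximalIdeal R • (⊤ : Submodule R F)) :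
    Module.finrank (R ⧸ maximalIdeal R) (X ⧸ (maximalIdeal R • ⊤ : Submodule R X)) =
    Module.finrank (R ⧸ maximalIdeal R) (F ⧸ (maximalIdeal R • ⊤ : Submodule R F)) +
    Module.finrank (R ⧸ maximalIdeal R) (M ⧸ (maximalIdeal R • ⊤ : Submodule R M)) := by
  let _ : Field (R ⧸ maximalIdeal R) := Ideal.Quotient.field _
  have hs : Function.Surjective (algebraMap R (R ⧸ maximalIdeal R)) :=
    Ideal.Quotient.mk_surjective
  have : Module.Finite (R ⧸ maximalIdeal R) (X ⧸ (maximalIdeal R • ⊤ : Submodule R X)) :=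
    Module.Finite.of_restrictScalars_finite R _ _
  let f1 : (F ⧸ (maximalIdeal R • ⊤ : Submodule R F)) →ₗ[R] _ :=
    Submodule.mapQ _ _ f (Submodule.smul_top_le_comap_smul_top (maximalIdeal R) f)
  let g1 : (X ⧸ (maximalIdeal R • ⊤ : Submodule R X)) →ₗ[R] _ :=
    Submodule.mapQ _ _ g (Submodule.smul_top_le_comap_smul_top (maximalIdeal R) g)
  let f2 := LinearMap.extendScalarsOfSurjective hs f1
  let g2 := LinearMap.extendScalarsOfSurjective hs g1
  have hf2 : Function.Injective f2 := by
    rw [injective_iff_map_eq_zero]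
    intro z hz
    obtain ⟨z, rfl⟩ := Submodule.mkQ_surjective _ z
    have hz' : f1 (Submodule.Quotient.mk z) = 0 := hz
    rw [Submodule.mapQ_apply, Submodule.Quotient.mk_eq_zero] at hz'
    exact (Submodule.Quotient.mk_eq_zero _).mpr (h z hz')
  have hg2 : Function.Surjective g2 := by
    intro z
    obtain ⟨z, rfl⟩ := Submodule.mkQ_surjective _ z
    obtain ⟨z, rfl⟩ := hg z
    exact ⟨Submodule.Quotient.mk z, rfl⟩
  have hk : LinearMap.ker g2 = LinearMap.range f2 := by
    ext z
    constructor
    · intro hz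
      obtain ⟨z, rfl⟩ := Submodule.mkQ_surjective _ z
      have hz' : g1 (Submodule.Quotient.mk z) = 0 := hz
      rw [Submodule.mapQ_apply, Submodule.Quotient.mk_eq_zero] at hz'
      have e : (maximalIdeal R • ⊤ : Submodule R M) = (maximalIdeal R • ⊤ : Submodule R X).map g := by
        rw [Submodule.map_smul'', Submodule.map_top, LinearMap.range_eq_top.mpr hg]
      rw [e] at hz'
      obtain ⟨w, hw, hwz⟩ := hz'
      obtain ⟨v, hv⟩ := (hfg (z - w)).mp (by rw [map_sub, hwz, sub_self])
      refine ⟨Submodule.Quotient.mk v, ?_⟩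
      change Submodule.Quotient.mk (f v) = Submodule.Quotient.mk z
      rw [hv, Submodule.Quotient.eq]
      simpa using hw
    · rintro ⟨z, rfl⟩
      obtain ⟨z, rfl⟩ := Submodule.mkQ_surjective _ z
      change Submodule.Quotient.mk (g (f z)) = 0
      rw [hfg.apply_apply_eq_zero]; rfl
  have e := LinearMap.finrank_range_add_finrank_ker g2
  rw [LinearMap.range_eq_top.mpr hg2, finrank_top, hk, LinearMap.finrank_range_of_inj hf2] at e
  rw [← e, add_comm]
  
lemma aux_main {R : Type} [CommRing R] [IsLocalRing R] [IsNoetherianRing R]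
    {F X : Type} [AddCommGroup F] [Module R F] [Module.Finite R F] [Module.Free R F]
    [AddCommGroup X] [Module R X]  (f : F →ₗ[R] X) (I : Ideal R) (hI : I ≤ maximalIdeal R)
    (h2 : maximalIdeal R ^ 2 = I * maximalIdeal R)
    (h : ∀ u, f u ∈ I • (⊤ : Submodule R X) → u ∈ I • (⊤ : Submodule R F))
    (u : F) (hu : f u ∈ maximalIdeal R • (⊤ : Submodule R X)) :
      u ∈ maximalIdeal R • (⊤ : Submodule R F) := by
  let b := Module.Free.chooseBasis R F
  by_contra hcon
  have hc := hcon
  rw [aux_coord _ b] at hc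
  push Not at hc
  obtain ⟨i, hi⟩ := hc
  have hunit : IsUnit (b.repr u i) := by simpa using hi
  have hmI : maximalIdeal R ≤ I := by
    intro a ha
    have h3 : f (a • u) ∈ I • (⊤ : Submodule R X) := by
      have : a • f u ∈ maximalIdeal R • maximalIdeal R • (⊤ : Submodule R X) :=
        Submodule.smul_mem_smul ha hu
      rw [← Submodule.mul_smul, ← pow_two, h2, Submodule.mul_smul] at this
      rw [map_smul]
      exact Submodule.smul_mono (le_refl I) le_top this
    have h4 := (aux_coord _ b _).mp (h _ h3) i
    simp only [map_smul, Finsupp.smul_apply, smul_eq_mul] at h4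
    exact (Ideal.mul_unit_mem_iff_mem I hunit).mp h4
  exact hcon (Submodule.smul_mono_left hI (h u (Submodule.smul_mono_left hmI hu)))

end Aux

/-- Let `(R,𝔪,k)` be a Cohen–Macaulay Noetherian local ring of dimension `d` with minimal
multiplicity, i.e. `𝔪² = (x₁,…,x_d)𝔪` for some system of parameters `x₁,…,x_d`.  Then for
every maximal Cohen–Macaulay module `M` and every finitely generated free module `F`, every
short exact sequence `0 → F → X → M → 0` of finitely generated modules is `μ`-additive:
`μ(X) = μ(F) + μ(M)`. -/
theorem stmt2 (R : Type) [CommRing R] [IsLocalRing R] [IsNoetherianRing R]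
    (d : ℕ) (hdim : ringKrullDim R = d) (hCM : depthGE R R d)
    (hminmult : ∃ x : Fin d → R, (∀ i, x i ∈ maximalIdeal R) ∧
      (∃ k : ℕ, maximalIdeal R ^ k ≤ Ideal.span (Set.range x)) ∧
      maximalIdeal R ^ 2 = Ideal.span (Set.range x) * maximalIdeal R) :
    ∀ (M : Type) [AddCommGroup M] [Module R M] [Module.Finite R M],
      depthGE R M d →
    ∀ (F : Type) [AddCommGroup F] [Module R F] [Module.Finite R F] [Module.Free R F],
    ∀ (X : Type) [AddCommGroup X] [Module R X] [Module.Finite R X]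
      (f : F →ₗ[R] X) (g : X →ₗ[R] M),
      Function.Injective f → Function.Surjective g → Function.Exact f g →
      mu R X = mu R F + mu R M := by
  obtain ⟨x, hxm, ⟨k, hk⟩, h2⟩ := hminmult
  intro M _ _ _ hM F _ _ _ _ X _ _ _ f g hf hg hfg
  have hI : Ideal.ofList (List.ofFn x) = Ideal.span (Set.range x) := by
    simp only [Ideal.ofList, List.mem_ofFn]
    rfl
  have hxs : ∀ r ∈ List.ofFn x, r ∈ maximalIdeal R := by
    intro r hr
    obtain ⟨i, rfl⟩ := List.mem_ofFn.mp hr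
    exact hxm i
  have hw : RingTheory.Sequence.IsWeaklyRegular M (List.ofFn x) := by
    refine aux_sop k _ hxs M ?_ ?_
    · rw [hI]
      exact hk.trans le_sup_right
    · rw [List.length_ofFn]
      exact hM
  refine aux_mu f g hg hfg ?_
  refine aux_main f (Ideal.span (Set.range x)) ?_ h2 ?_
  · rw [Ideal.span_le]
    rintro _ ⟨i, rfl⟩
    exact hxm i
  · rw [← hI]
    exact aux_inj _ f g hf hg hfg hw
end

section
/- Let (R,m,k) be a non-regular Cohen–Macaulay Noetherian local ring of dimension d ≥ 1, and let N be a nonzero finitely generated R-module of finite injective dimension. Then every short exact sequence 0 → N → X → Ω^{d−1}_R k → 0 of finitely generated R-modules is μ-additive (i.e., μ(X) = μ(N) + μ(Ω^{d−1}_R k)), and Ext^1_R(Ω^{d−1}_R k, N) ≠ 0, so there exists a non-split such sequence; in other words Ext^1_R(Ω^{d−1}_R k, N)^μ = Ext^1_R(Ω^{d−1}_R k, N) ≠ 0. -/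
open IsLocalRing

namespace MuAdd

open CategoryTheory Abelian

section Aux

variable {R : Type} [CommRing R]

/-- Shorthand for Ext groups of modules. -/
abbrev EE (R : Type) [CommRing R] (M N : Type) [AddCommGroup M] [Module R M]
    [AddCommGroup N] [Module R N] (n : ℕ) : Type :=
  Ext (ModuleCat.of R M) (ModuleCat.of R N) n

lemma ses_mk {A B C : Type} [AddCommGroup A] [Module R A] [AddCommGroup B] [Module R B]
    [AddCommGroup C] [Module R C] (i : A →ₗ[R] B) (p : B →ₗ[R] C)
    (hi : Function.Injective i) (hp : Function.Surjective p) (he : Function.Exact i p) :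
    (ModuleCat.shortComplexOfCompEqZero i p he.linearMap_comp_eq_zero).ShortExact :=
  ModuleCat.shortComplex_shortExact _ he hi hp

lemma smul_ext_src {M N : ModuleCat.{0} R} {n : ℕ} (r : R) (e : Ext M N n) :
    (Ext.mk₀ (r • 𝟙 M)).comp e (zero_add n) = r • e := by
  simp [Ext.mk₀_smul]

lemma smul_ext_tgt {M N : ModuleCat.{0} R} {n : ℕ} (r : R) (e : Ext M N n) :
    e.comp (Ext.mk₀ (r • 𝟙 N)) (add_zero n) = r • e := by
  simp [Ext.mk₀_smul]

lemma smul_ext_zero {M N : ModuleCat.{0} R} {n : ℕ} (r : R) (h : ∀ x : M, r • x = 0)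
    (e : Ext M N n) : r • e = 0 := by
  rw [← smul_ext_src]
  have : r • 𝟙 M = 0 := by
    ext x; exact h x
  simp [this]

/-- The inclusion data for `0 → R/I → R/I → R/(I+x) → 0`. -/
lemma quot_ses (I : Ideal R) (x : R) (h : ∀ a, x * a ∈ I → a ∈ I) :
    Function.Injective (LinearMap.lsmul R (R ⧸ I) x) ∧
    Function.Surjective (Submodule.factor (le_sup_left : I ≤ I ⊔ Ideal.span {x})) ∧
    Function.Exact (LinearMap.lsmul R (R ⧸ I) x)
      (Submodule.factor (le_sup_left : I ≤ I ⊔ Ideal.span {x})) := by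
  refine ⟨?_, Submodule.factor_surjective _, ?_⟩
  · rw [injective_iff_map_eq_zero]
    intro a ha
    obtain ⟨a, rfl⟩ := Submodule.mkQ_surjective _ a
    have : (Submodule.Quotient.mk (x • a) : R ⧸ I) = 0 := ha
    rw [Submodule.Quotient.mk_eq_zero] at this
    exact (Submodule.Quotient.mk_eq_zero _).2 (h a this)
  · intro a
    obtain ⟨a, rfl⟩ := Submodule.mkQ_surjective _ a
    constructor
    · intro ha
      have : a ∈ I ⊔ Ideal.span {x} := (Submodule.Quotient.mk_eq_zero _).1 ha
      obtain ⟨y, hy, z, hz, rfl⟩ := Submodule.mem_sup.1 this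
      obtain ⟨c, rfl⟩ := Ideal.mem_span_singleton'.1 hz
      refine ⟨Submodule.mkQ I c, ?_⟩
      have : (Submodule.Quotient.mk (x • c) : R ⧸ I) = Submodule.Quotient.mk (y + c * x) := by
        rw [Submodule.Quotient.eq]
        have : x • c - (y + c * x) = -y := by simp; ring
        rw [this]; exact I.neg_mem hy
      exact this
    · rintro ⟨c, hc⟩
      obtain ⟨c, rfl⟩ := Submodule.mkQ_surjective _ c
      rw [← hc]
      change (Submodule.Quotient.mk (x • c) : R ⧸ (I ⊔ Ideal.span {x})) = 0
      rw [Submodule.Quotient.mk_eq_zero]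
      exact Ideal.mem_sup_right (Ideal.mem_span_singleton'.2 ⟨c, mul_comm _ _⟩)

variable [IsLocalRing R]

/-- Regular sequences that are part of a minimal generating set of the maximal ideal. -/
inductive GoodSeq (R : Type) [CommRing R] [IsLocalRing R] : ℕ → Ideal R → Prop
  | zero : GoodSeq R 0 ⊥
  | succ (j : ℕ) (I : Ideal R) (x : R) (h : GoodSeq R j I) (hx : x ∈ maximalIdeal R)
      (hx2 : x ∉ maximalIdeal R ^ 2 ⊔ I) (hreg : ∀ a, x * a ∈ I → a ∈ I) :
      GoodSeq R (j + 1) (I ⊔ Ideal.span {x})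

lemma GoodSeq.le {j : ℕ} {I : Ideal R} (h : GoodSeq R j I) : I ≤ maximalIdeal R := by
  induction h with
  | zero => exact bot_le
  | succ j I x h hx hx2 hreg ih =>
    exact sup_le ih ((Ideal.span_singleton_le_iff_mem _).2 hx)

lemma GoodSeq.pd {j : ℕ} {I : Ideal R} (h : GoodSeq R j I) (N : ModuleCat.{0} R) (n : ℕ)
    (hn : j < n) : Subsingleton (Ext (ModuleCat.of R (R ⧸ I)) N n) := by
  induction h generalizing n with
  | zero =>
    obtain ⟨n, rfl⟩ : ∃ m, n = m + 1 := ⟨n - 1, by omega⟩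
    have : Projective (ModuleCat.of R (R ⧸ (⊥ : Ideal R))) := by
      have e : (R ⧸ (⊥ : Ideal R)) ≃ₗ[R] R := Submodule.quotEquivOfEqBot ⊥ rfl
      have : Module.Projective R (R ⧸ (⊥ : Ideal R)) := Module.Projective.of_equiv e.symm
      infer_instance
    exact ⟨fun a b => by rw [Ext.eq_zero_of_projective a, Ext.eq_zero_of_projective b]⟩
  | succ j I x h hx hx2 hreg ih =>
    obtain ⟨n, rfl⟩ : ∃ m, n = m + 1 := ⟨n - 1, by omega⟩
    obtain ⟨h1, h2, h3⟩ := quot_ses I x hreg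
    have hs := ses_mk _ _ h1 h2 h3
    have key : ∀ a : Ext (ModuleCat.of R (R ⧸ (I ⊔ Ideal.span {x}))) N (n+1), a = 0 := by
      intro a
      have := ih (n+1) (by omega)
      have := ih n (by omega)
      obtain ⟨y, rfl⟩ := Ext.contravariant_sequence_exact₃ hs N a (Subsingleton.elim _ _)
        (add_comm 1 n)
      have : y = 0 := Subsingleton.elim _ _
      simp [this]
    exact ⟨fun a b => by rw [key a, key b]⟩

lemma GoodSeq.span {j : ℕ} {I : Ideal R} (h : GoodSeq R j I) :
    ∃ x : Fin j → R, Ideal.span (Set.range x) = I := by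
  induction h with
  | zero => exact ⟨Fin.elim0, by simp⟩
  | succ j I x h hx hx2 hreg ih =>
    obtain ⟨y, rfl⟩ := ih
    refine ⟨Fin.cons x y, ?_⟩
    rw [Fin.range_cons, Ideal.span_insert, sup_comm]

lemma GoodSeq.dim {j : ℕ} {I : Ideal R} (h : GoodSeq R j I) :
    ringKrullDim (R ⧸ I) + j ≤ ringKrullDim R := by
  induction h with
  | zero =>
    simpa using ringKrullDim_quotient_le (⊥ : Ideal R)
  | succ j I x h hx hx2 hreg ih =>
    refine le_trans ?_ ih
    have hle : I ≤ I ⊔ Ideal.span {x} := le_sup_left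
    have := ringKrullDim_succ_le_of_surjective (Ideal.Quotient.factor hle)
      (Ideal.Quotient.factor_surjective hle) (r := Ideal.Quotient.mk I x) ?_ ?_
    · push_cast
      rw [add_comm (j : WithBot ℕ∞) 1, ← add_assoc]
      gcongr
    · rw [mem_nonZeroDivisors_iff_right]
      intro a ha
      obtain ⟨a, rfl⟩ := Ideal.Quotient.mk_surjective a
      rw [← map_mul, Ideal.Quotient.eq_zero_iff_mem] at ha
      rw [Ideal.Quotient.eq_zero_iff_mem]
      exact hreg a (by rwa [mul_comm])
    · rw [Ideal.Quotient.factor_mk, Ideal.Quotient.eq_zero_iff_mem]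
      exact Ideal.mem_sup_right (Ideal.mem_span_singleton_self x)

/-- Vanishing of `Ext^i(k, M)` for `i < n`. -/
def ExtDepth (R : Type) [CommRing R] [IsLocalRing R] (M : ModuleCat.{0} R) (n : ℕ) : Prop :=
  ∀ i < n, Subsingleton (Ext (ModuleCat.of R (R ⧸ maximalIdeal R)) M i)

lemma residue_smul (r : R) (hr : r ∈ maximalIdeal R) (x : R ⧸ maximalIdeal R) : r • x = 0 := by
  obtain ⟨x, rfl⟩ := Ideal.Quotient.mk_surjective x
  rw [← Ideal.Quotient.mk_eq_mk, ← Submodule.Quotient.mk_smul]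
  exact (Submodule.Quotient.mk_eq_zero _).2 (Ideal.mul_mem_right _ _ hr)

lemma extDepth_of_regular (rs : List R) (hrs : ∀ r ∈ rs, r ∈ maximalIdeal R)
    (M : ModuleCat.{0} R) (h : RingTheory.Sequence.IsWeaklyRegular M rs) :
    ExtDepth R M rs.length := by
  induction rs generalizing M with
  | nil => intro i hi; simp at hi
  | cons r rs ih =>
    rw [RingTheory.Sequence.isWeaklyRegular_cons_iff] at h
    have ih' := ih (fun s hs => hrs s (by simp [hs])) (ModuleCat.of R (QuotSMulTop r M)) h.2
    have hs := h.1.smulShortComplex_shortExact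
    intro i hi
    have key : ∀ a : Ext (ModuleCat.of R (R ⧸ maximalIdeal R)) M i, a = 0 := by
      intro a
      have ha : a.comp (Ext.mk₀ (M.smulShortComplex r).f) (add_zero i) = 0 := by
        rw [ModuleCat.smulShortComplex_f_eq_smul_id]
        exact (smul_ext_tgt r a).trans
          (smul_ext_zero r (fun x => residue_smul r (hrs r (by simp)) x) a)
      rcases i with _ | i
      · have hm := hs.mono_f
        have hz := ((Ext.mk₀ (M.smulShortComplex r).f).postcomp
          (ModuleCat.of R (R ⧸ maximalIdeal R)) (add_zero 0)).map_zero
        exact Ext.postcomp_mk₀_injective_of_mono _ (M.smulShortComplex r).f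
          (ha.trans hz.symm)
      · obtain ⟨y, rfl⟩ := Ext.covariant_sequence_exact₁ _ hs a ha rfl
        have := ih' i (by simp at hi; omega)
        have : y = 0 := Subsingleton.elim (α := Ext (ModuleCat.of R (R ⧸ maximalIdeal R)) (ModuleCat.of R (QuotSMulTop r M)) i) _ _
        rw [this, Ext.zero_comp]; rfl
    exact ⟨fun a b => by rw [key a, key b]⟩

lemma extDepth_quot (I : Ideal R) (x : R) (hreg : ∀ a, x * a ∈ I → a ∈ I) (n : ℕ)
    (h : ExtDepth R (ModuleCat.of R (R ⧸ I)) (n+1)) :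
    ExtDepth R (ModuleCat.of R (R ⧸ (I ⊔ Ideal.span {x}))) n := by
  intro i hi
  obtain ⟨h1, h2, h3⟩ := quot_ses I x hreg
  have hs := ses_mk _ _ h1 h2 h3
  have key : ∀ a : Ext (ModuleCat.of R (R ⧸ maximalIdeal R))
      (ModuleCat.of R (R ⧸ (I ⊔ Ideal.span {x}))) i, a = 0 := by
    intro a
    have := h (i+1) (by omega)
    have := h i (by omega)
    obtain ⟨y, rfl⟩ := Ext.covariant_sequence_exact₃ _ hs a rfl (Subsingleton.elim _ _)
    have : y = 0 := Subsingleton.elim _ _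
    simp [this]
  exact ⟨fun a b => by rw [key a, key b]⟩

/-- The map `k → M` given by a socle element. -/
noncomputable def socMap {M : Type} [AddCommGroup M] [Module R M] (y : M)
    (hy : ∀ a ∈ maximalIdeal R, a • y = 0) : (R ⧸ maximalIdeal R) →ₗ[R] M :=
  Submodule.liftQ _ (LinearMap.toSpanSingleton R M y) (fun a ha => by simpa using hy a ha)

lemma socMap_mk {M : Type} [AddCommGroup M] [Module R M] (y : M)
    (hy : ∀ a ∈ maximalIdeal R, a • y = 0) (r : R) :
    socMap y hy (Ideal.Quotient.mk _ r) = r • y := by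
  change Submodule.liftQ _ _ _ (Submodule.Quotient.mk r) = _
  rw [Submodule.liftQ_apply]; simp

lemma soc_eq_zero {M : Type} [AddCommGroup M] [Module R M]
    (h : Subsingleton (EE R (R ⧸ maximalIdeal R) M 0)) (y : M)
    (hy : ∀ a ∈ maximalIdeal R, a • y = 0) : y = 0 := by
  have : Ext.mk₀ (ModuleCat.ofHom (socMap y hy)) = 0 := Subsingleton.elim _ _
  rw [Ext.mk₀_eq_zero_iff] at this
  have h2 : socMap y hy (Ideal.Quotient.mk _ 1) = 0 := by
    have := congrArg (fun f => f.hom (Ideal.Quotient.mk _ 1)) this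
    simpa using this
  rw [socMap_mk] at h2
  simpa using h2

lemma GoodSeq.exists_next [IsNoetherianRing R] {j : ℕ} {I : Ideal R} (h : GoodSeq R j I)
    (hD : Subsingleton (EE R (R ⧸ maximalIdeal R) (R ⧸ I) 0)) :
    ∃ x, x ∈ maximalIdeal R ∧ x ∉ maximalIdeal R ^ 2 ⊔ I ∧ ∀ a, x * a ∈ I → a ∈ I := by
  by_contra hcon
  push Not at hcon
  have hsub : ((maximalIdeal R : Ideal R) : Set R) ⊆
      ⋃ P ∈ insert (maximalIdeal R ^ 2 ⊔ I) (associatedPrimes R (R ⧸ I)),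
        ((id P : Ideal R) : Set R) := by
    intro x hx
    by_cases hx2 : x ∈ maximalIdeal R ^ 2 ⊔ I
    · exact Set.mem_biUnion (Set.mem_insert _ _) hx2
    · obtain ⟨a, ha, ha'⟩ := hcon x hx hx2
      have : x ∈ ⋃ P ∈ associatedPrimes R (R ⧸ I), ((P : Ideal R) : Set R) := by
        rw [biUnion_associatedPrimes_eq_zero_divisors]
        refine ⟨Ideal.Quotient.mk I a, ?_, ?_⟩
        · rwa [Ne, Ideal.Quotient.eq_zero_iff_mem]
        · change Ideal.Quotient.mk I (x * a) = 0
          rwa [Ideal.Quotient.eq_zero_iff_mem]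
      rw [Set.biUnion_insert]
      exact Or.inr this
  rw [Ideal.subset_union_prime_finite ((associatedPrimes.finite R (R ⧸ I)).insert _)
    (maximalIdeal R ^ 2 ⊔ I) (maximalIdeal R ^ 2 ⊔ I)] at hsub
  · obtain ⟨P, hP, hle⟩ := hsub
    rcases hP with rfl | hP
    · have : maximalIdeal R ≤ I := by
        refine Submodule.le_of_le_smul_of_le_jacobson_bot (I := maximalIdeal R)
          (IsNoetherian.noetherian _) (IsLocalRing.maximalIdeal_le_jacobson _) ?_
        simpa [pow_two, sup_comm] using hle
      have h1 := soc_eq_zero hD (Ideal.Quotient.mk I 1) (by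
        intro a ha
        change Ideal.Quotient.mk I (a * 1) = 0
        rw [Ideal.Quotient.eq_zero_iff_mem]
        simpa using this ha)
      rw [Ideal.Quotient.eq_zero_iff_mem] at h1
      exact (Ideal.ne_top_iff_one _).1 (maximalIdeal.isMaximal R).ne_top (h.le h1)
    · obtain ⟨hprime, y, hy⟩ := (isAssociatedPrime_iff).1 (AssociatedPrimes.mem_iff.1 hP)
      simp only [id] at hle
      have h1 := soc_eq_zero hD y (by
        intro a ha
        have := hle ha
        rw [hy] at this
        simpa [Submodule.mem_colon_singleton] using this)
      apply hprime.ne_top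
      rw [hy, h1]; simp
  · intro P hP hne _
    rcases hP with rfl | hP
    · exact absurd rfl hne
    · exact hP.1

lemma exists_goodSeq [IsNoetherianRing R] (d : ℕ) (h : ExtDepth R (ModuleCat.of R R) d) :
    ∃ I, GoodSeq R d I := by
  have hb : ExtDepth R (ModuleCat.of R (R ⧸ (⊥ : Ideal R))) d := by
    intro i hi
    have := h i hi
    have e : ModuleCat.of R (R ⧸ (⊥ : Ideal R)) ≅ ModuleCat.of R R :=
      (Submodule.quotEquivOfEqBot (⊥ : Ideal R) rfl).toModuleIso
    have key : ∀ a : Ext (ModuleCat.of R (R ⧸ maximalIdeal R))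
        (ModuleCat.of R (R ⧸ (⊥ : Ideal R))) i, a = 0 := by
      intro a
      have h0 : a.comp (Ext.mk₀ e.hom) (add_zero i) = 0 := Subsingleton.elim _ _
      have h1 : (a.comp (Ext.mk₀ e.hom) (add_zero i)).comp (Ext.mk₀ e.inv) (add_zero i) = 0 := by
        rw [h0]; simp
      rw [Ext.comp_assoc_of_second_deg_zero, Ext.mk₀_comp_mk₀] at h1
      simpa using h1
    exact ⟨fun a b => by rw [key a, key b]⟩
  have : ∀ j ≤ d, ∃ I, GoodSeq R j I ∧ ExtDepth R (ModuleCat.of R (R ⧸ I)) (d - j) := by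
    intro j
    induction j with
    | zero => intro _; exact ⟨⊥, .zero, hb⟩
    | succ j ih =>
      intro hj
      obtain ⟨I, hI, hD⟩ := ih (by omega)
      obtain ⟨x, hx, hx2, hreg⟩ := hI.exists_next (hD 0 (by omega))
      refine ⟨_, .succ j I x hI hx hx2 hreg, ?_⟩
      apply extDepth_quot I x hreg
      rwa [show d - (j+1) + 1 = d - j by omega]
  obtain ⟨I, hI, _⟩ := this d le_rfl
  exact ⟨I, hI⟩

end Aux

section Aux2

variable {R : Type} [CommRing R] [IsLocalRing R]

lemma ext_finlen_aux [IsNoetherianRing R] (N : ModuleCat.{0} R) (i : ℕ)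
    (hk : Subsingleton (Ext (ModuleCat.of R (R ⧸ maximalIdeal R)) N i)) (n : ℕ)
    (M : Type) [AddCommGroup M] [Module R M] (hM : Module.Finite R M) :
    (∀ a ∈ maximalIdeal R ^ n, ∀ x : M, a • x = 0) →
      ∀ e : Ext (ModuleCat.of R M) N i, e = 0 := by
  induction hM using IsNoetherianRing.induction_on_isQuotientEquivQuotientPrime R with
  | subsingleton M =>
    intro _ e
    have h0 : (𝟙 (ModuleCat.of R M)) = 0 := by ext x; exact Subsingleton.elim _ _
    rw [← Ext.mk₀_id_comp e, h0]; simp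
  | quotient M p e =>
    intro h a
    have hp : p.1 = maximalIdeal R := by
      have : maximalIdeal R ^ n ≤ p.1 := by
        intro r hr
        have h1 := h r hr (e.symm (Ideal.Quotient.mk _ 1))
        rw [← map_smul] at h1
        have h2 : Ideal.Quotient.mk p.1 (r * 1) = 0 := 
          (LinearEquiv.map_eq_zero_iff e.symm).1 h1
        rw [Ideal.Quotient.eq_zero_iff_mem] at h2
        simpa using h2
      have h3 := p.2.le_of_pow_le this
      exact ((maximalIdeal.isMaximal R).eq_of_le p.2.ne_top h3).symm
    rw [hp] at e
    have e' : ModuleCat.of R M ≅ ModuleCat.of R (R ⧸ maximalIdeal R) := e.toModuleIso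
    have h0 : (Ext.mk₀ e'.inv).comp a (zero_add i) = 0 := Subsingleton.elim _ _
    have h1 : (Ext.mk₀ e'.hom).comp ((Ext.mk₀ e'.inv).comp a (zero_add i)) (zero_add i) = 0 := by
      rw [h0]; simp
    rw [Ext.mk₀_comp_mk₀_assoc] at h1
    simpa using h1
  | exact M1 M2 M3 f g hf hg hfg h1 h3 =>
    intro h a
    have hs := ses_mk f g hf hg hfg
    obtain ⟨y, rfl⟩ := Ext.contravariant_sequence_exact₂ hs N a (h1 (by
      intro r hr x
      apply hf
      rw [map_smul, h r hr, map_zero]) _)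
    have : y = 0 := h3 (by
      intro r hr x
      obtain ⟨x, rfl⟩ := hg x
      rw [← map_smul, h r hr, map_zero]) _
    rw [this]; simp

lemma ext_finlen [IsNoetherianRing R] (N : ModuleCat.{0} R) (i : ℕ)
    (hk : Subsingleton (Ext (ModuleCat.of R (R ⧸ maximalIdeal R)) N i))
    (M : Type) [AddCommGroup M] [Module R M] (hM : Module.Finite R M)
    (n : ℕ) (hn : ∀ a ∈ maximalIdeal R ^ n, ∀ x : M, a • x = 0) :
    Subsingleton (Ext (ModuleCat.of R M) N i) := by
  have key := ext_finlen_aux N i hk n M hM hn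
  exact ⟨fun a b => by rw [key a, key b]⟩

lemma GoodSeq.pow_le [IsNoetherianRing R] {d : ℕ} {I : Ideal R} (h : GoodSeq R d I)
    (hdim : ringKrullDim R = d) : ∃ n, maximalIdeal R ^ n ≤ I := by
  have hI : I ≠ ⊤ := fun hh => (maximalIdeal.isMaximal R).ne_top (top_le_iff.1 (hh ▸ h.le))
  have : Nontrivial (R ⧸ I) := Ideal.Quotient.nontrivial_iff.2 hI
  have hl : IsLocalRing (R ⧸ I) := IsLocalRing.of_surjective' (Ideal.Quotient.mk I)
    Ideal.Quotient.mk_surjective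
  have h1 := h.dim
  rw [hdim] at h1
  have h2 : ringKrullDim (R ⧸ I) ≤ 0 := by
    have : ringKrullDim (R ⧸ I) + (d : WithBot ℕ∞) ≤ 0 + d := by simpa using h1
    exact ENat.WithBot.add_le_add_natCast_right_iff.1 this
  have h3 : IsArtinianRing (R ⧸ I) := by
    rw [isArtinianRing_iff_krullDimLE_zero, Ring.KrullDimLE, Order.krullDimLE_iff]
    simpa using! h2
  obtain ⟨n, hn⟩ := (isArtinianRing_iff_isNilpotent_maximalIdeal (R ⧸ I)).1 h3
  refine ⟨n, ?_⟩
  have h4 : (maximalIdeal R).map (Ideal.Quotient.mk I) ≤ maximalIdeal (R ⧸ I) := by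
    apply IsLocalRing.le_maximalIdeal
    rw [Ne, Ideal.eq_top_iff_one, Ideal.mem_map_iff_of_surjective _ Ideal.Quotient.mk_surjective]
    rintro ⟨a, ha, ha1⟩
    rw [← map_one (Ideal.Quotient.mk I), Ideal.Quotient.eq] at ha1
    have h6 := (maximalIdeal R).sub_mem ha (h.le ha1)
    rw [sub_sub_cancel] at h6
    exact (Ideal.ne_top_iff_one _).1 (maximalIdeal.isMaximal R).ne_top h6
  have h5 : (maximalIdeal R ^ n).map (Ideal.Quotient.mk I) = ⊥ := by
    rw [Ideal.map_pow, eq_bot_iff]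
    exact (Ideal.pow_right_mono h4 n).trans (by rw [hn]; exact le_rfl)
  rw [Ideal.map_eq_bot_iff_le_ker, Ideal.mk_ker] at h5
  exact h5

lemma exists_soc {I : Ideal R} (hI : I ≤ maximalIdeal R) (hne : I ≠ maximalIdeal R) (n : ℕ)
    (hn : maximalIdeal R ^ n ≤ I) :
    ∃ s ∈ maximalIdeal R, s ∉ I ∧ ∀ a ∈ maximalIdeal R, a * s ∈ I := by
  classical
  have hex : ∃ n, maximalIdeal R ^ n ≤ I := ⟨n, hn⟩
  obtain ⟨n, hn, hmin⟩ : ∃ n, maximalIdeal R ^ n ≤ I ∧ ∀ m < n, ¬ maximalIdeal R ^ m ≤ I :=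
    ⟨Nat.find hex, Nat.find_spec hex, fun m hm => Nat.find_min hex hm⟩
  rcases n with _ | _ | n
  · rw [pow_zero, Ideal.one_eq_top, top_le_iff] at hn
    exact absurd (top_le_iff.1 (hn ▸ hI)) (maximalIdeal.isMaximal R).ne_top
  · rw [zero_add, pow_one] at hn
    exact absurd (le_antisymm hI hn) hne
  · obtain ⟨s, hs, hsI⟩ := SetLike.not_le_iff_exists.1 (hmin (n+1) (by omega))
    refine ⟨s, Ideal.pow_le_self (by omega) hs, hsI, fun a ha => hn ?_⟩
    rw [pow_succ']
    exact Ideal.mul_mem_mul ha hs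

lemma injdim_bound {N : Type} [AddCommGroup N] [Module R N]
    (hinj : ∃ (n : ℕ) (I : ℕ → ModuleCat.{0} R) (f : ∀ j : ℕ, (I j →ₗ[R] I (j+1)))
    (ι : N →ₗ[R] I 0),
    (∀ j, Module.Injective R (I j)) ∧
    Function.Injective ι ∧
    Function.Exact ι (f 0) ∧
    (∀ j, Function.Exact (f j) (f (j+1))) ∧
    (∀ j, n < j → Subsingleton (I j))) :
    ∃ n, HasInjectiveDimensionLT (ModuleCat.of R N) n := by
  obtain ⟨n, I, f, ι, hI, hι, he0, he, hsub⟩ := hinj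
  have key : ∀ t ≤ n + 1, HasInjectiveDimensionLT
      (ModuleCat.of R (LinearMap.ker (f (n + 1 - t)))) t := by
    intro t
    induction t with
    | zero =>
      intro _
      have := hsub (n+1) (by omega)
      have : Subsingleton (LinearMap.ker (f (n+1-0))) := by
        rw [Nat.sub_zero]; infer_instance
      apply Limits.IsZero.hasInjectiveDimensionLT_zero
      exact ModuleCat.isZero_of_subsingleton _
    | succ t ih =>
      intro ht
      have ih := ih (by omega)
      obtain ⟨j, hj⟩ : ∃ j, j = n + 1 - (t + 1) := ⟨_, rfl⟩
      rw [show n + 1 - t = j + 1 by omega] at ih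
      rw [← hj]
      let g : I j →ₗ[R] LinearMap.ker (f (j+1)) := (f j).codRestrict _ (fun x => by
        rw [LinearMap.mem_ker]; exact (he j _).2 ⟨x, rfl⟩)
      have hs := ses_mk (LinearMap.ker (f j)).subtype g (Submodule.subtype_injective _) (by
        rintro ⟨y, hy⟩
        obtain ⟨x, hx⟩ := (he j y).1 hy
        exact ⟨x, Subtype.ext hx⟩) (by
        intro x
        constructor
        · intro hx
          exact ⟨⟨x, congrArg Subtype.val hx⟩, rfl⟩
        · rintro ⟨y, rfl⟩
          exact Subtype.ext y.2)
      have := hI j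
      have : Injective (ModuleCat.of R (I j)) := Module.injective_object_of_injective_module R (I j)
      exact hs.hasInjectiveDimensionLT_X₁ t ih (hasInjectiveDimensionLT_of_ge _ 1 _ (by omega))
  refine ⟨n+1, ?_⟩
  have h := key (n+1) le_rfl
  rw [Nat.sub_self] at h
  have e : N ≃ₗ[R] LinearMap.ker (f 0) :=
    (LinearEquiv.ofInjective ι hι).trans (LinearEquiv.ofEq _ _ (LinearMap.exact_iff.1 he0).symm)
  exact hasInjectiveDimensionLT_of_iso (X := ModuleCat.of R (LinearMap.ker (f 0)))
    e.symm.toModuleIso (n+1)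

lemma socMap_injective {M : Type} [AddCommGroup M] [Module R M] (y : M) (hne : y ≠ 0)
    (hy : ∀ a ∈ maximalIdeal R, a • y = 0) : Function.Injective (socMap y hy) := by
  rw [injective_iff_map_eq_zero]
  intro a ha
  obtain ⟨a, rfl⟩ := Ideal.Quotient.mk_surjective a
  rw [socMap_mk] at ha
  rw [Ideal.Quotient.eq_zero_iff_mem]
  by_contra hu
  rw [mem_maximalIdeal, mem_nonunits_iff, not_not] at hu
  exact hne ((hu.smul_eq_zero).1 ha)

lemma soc_surj [IsNoetherianRing R] (N : ModuleCat.{0} R) (I : Ideal R) (n : ℕ)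
    (hn : maximalIdeal R ^ n ≤ I) (y : R ⧸ I) (hne : y ≠ 0)
    (hy : ∀ a ∈ maximalIdeal R, a • y = 0) (i : ℕ)
    (hk : Subsingleton (Ext (ModuleCat.of R (R ⧸ maximalIdeal R)) N (i+1)))
    (e : Ext (ModuleCat.of R (R ⧸ maximalIdeal R)) N i) :
    ∃ z : Ext (ModuleCat.of R (R ⧸ I)) N i,
      (Ext.mk₀ (ModuleCat.ofHom (socMap y hy))).comp z (zero_add i) = e := by
  have hs := ses_mk (socMap y hy) (LinearMap.range (socMap y hy)).mkQ
    (socMap_injective y hne hy) (Submodule.mkQ_surjective _) (LinearMap.exact_map_mkQ_range _)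
  have := ext_finlen N (i+1) hk ((R ⧸ I) ⧸ LinearMap.range (socMap y hy)) inferInstance n (by
    intro a ha x
    obtain ⟨x, rfl⟩ := Submodule.mkQ_surjective _ x
    obtain ⟨x, rfl⟩ := Ideal.Quotient.mk_surjective x
    have : a • Ideal.Quotient.mk I x = 0 := by
      change Ideal.Quotient.mk I (a * x) = 0
      rw [Ideal.Quotient.eq_zero_iff_mem]
      exact Ideal.mul_mem_right _ _ (hn ha)
    rw [← map_smul, this, map_zero])
  exact Ext.contravariant_sequence_exact₁ hs N e (add_comm 1 i) (Subsingleton.elim _ _)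

lemma ext_residue_vanish [IsNoetherianRing R] (N : ModuleCat.{0} R) {d : ℕ} {I : Ideal R}
    (h : GoodSeq R d I) (n : ℕ)
    (hn : maximalIdeal R ^ n ≤ I) (y : R ⧸ I) (hne : y ≠ 0)
    (hy : ∀ a ∈ maximalIdeal R, a • y = 0) (B : ℕ) (hB : HasInjectiveDimensionLT N B) (i : ℕ)
    (hi : d < i) : Subsingleton (Ext (ModuleCat.of R (R ⧸ maximalIdeal R)) N i) := by
  have key : ∀ t : ℕ, ∀ i, d < i → B ≤ i + t →
      Subsingleton (Ext (ModuleCat.of R (R ⧸ maximalIdeal R)) N i) := by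
    intro t
    induction t with
    | zero =>
      intro i _ h
      exact HasInjectiveDimensionLT.subsingleton N B i h _
    | succ t ih =>
      intro i hi hBi
      have h1 := ih (i+1) (by omega) (by omega)
      have h2 := h.pd N i hi
      have : ∀ e : Ext (ModuleCat.of R (R ⧸ maximalIdeal R)) N i, e = 0 := by
        intro e
        obtain ⟨z, rfl⟩ := soc_surj N I n hn y hne hy i h1 e
        have : z = 0 := Subsingleton.elim _ _
        simp [this]
      exact ⟨fun a b => by rw [this a, this b]⟩
  exact key B i hi (by omega)

lemma GoodSeq.nontrivial [IsNoetherianRing R] (N : ModuleCat.{0} R) [Module.Finite R N]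
    [Nontrivial N] {j : ℕ} {I : Ideal R} (h : GoodSeq R j I) :
    Nontrivial (Ext (ModuleCat.of R (R ⧸ I)) N j) := by
  induction h with
  | zero =>
    obtain ⟨y, hy⟩ := exists_ne (0 : N)
    let e : (R ⧸ (⊥ : Ideal R)) ≃ₗ[R] R := Submodule.quotEquivOfEqBot ⊥ rfl
    refine ⟨Ext.mk₀ (ModuleCat.ofHom ((LinearMap.toSpanSingleton R N y).comp e.toLinearMap)), 0, ?_⟩
    rw [Ne, Ext.mk₀_eq_zero_iff]
    intro h0
    apply hy
    have := congrArg (fun f => f.hom (e.symm 1)) h0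
    simpa using this
  | succ j I x h hx hx2 hreg ih =>
    by_contra hcon
    rw [not_nontrivial_iff_subsingleton] at hcon
    obtain ⟨h1, h2, h3⟩ := quot_ses I x hreg
    have hs := ses_mk _ _ h1 h2 h3
    have hfin : Module.Finite R (Ext (ModuleCat.of R (R ⧸ I)) N j) := inferInstance
    have hbot : (⊤ : Submodule R (Ext (ModuleCat.of R (R ⧸ I)) N j)) = ⊥ := by
      refine Submodule.eq_bot_of_le_smul_of_le_jacobson_bot (maximalIdeal R) _ hfin.1 ?_
        (IsLocalRing.maximalIdeal_le_jacobson _)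
      intro y _
      obtain ⟨y', hy'⟩ := Ext.contravariant_sequence_exact₁ hs N y (add_comm 1 j)
        (Subsingleton.elim _ _)
      have : x • y' = y := by
        rw [← hy', ← smul_ext_src]
        rfl
      rw [← this]
      exact Submodule.smul_mem_smul hx trivial
    obtain ⟨y, hy⟩ := exists_ne (0 : Ext (ModuleCat.of R (R ⧸ I)) N j)
    exact hy ((Submodule.mem_bot R).1 (hbot ▸ (trivial : y ∈ (⊤ : Submodule R _))))

lemma step_lift {A C : Type} [AddCommGroup A] [Module R A] [AddCommGroup C] [Module R C] {b : ℕ}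
    (i : A →ₗ[R] (Fin b → R)) (p : (Fin b → R) →ₗ[R] C) (he : Function.Exact i p)
    (hi : ∀ a, i a ∈ maximalIdeal R • (⊤ : Submodule R (Fin b → R)))
    (I : Ideal R) (hI : I ≤ maximalIdeal R) (x : R) (hx2 : x ∉ maximalIdeal R ^ 2 ⊔ I)
    (hreg : ∀ a, x * a ∈ I → a ∈ I)
    (u : C →ₗ[R] R ⧸ (I ⊔ Ideal.span {x}))
    (hu : ∀ c, ∃ r ∈ maximalIdeal R, u c = Submodule.Quotient.mk r) :
    ∃ (v : A →ₗ[R] R ⧸ I) (G : (Fin b → R) →ₗ[R] R ⧸ I),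
      (Submodule.factor (le_sup_left : I ≤ I ⊔ Ideal.span {x})).comp G = u.comp p ∧
      (LinearMap.lsmul R (R ⧸ I) x).comp v = G.comp i ∧
      ∀ a, ∃ r ∈ maximalIdeal R, v a = Submodule.Quotient.mk r := by
  obtain ⟨h1, h2, h3⟩ := quot_ses I x hreg
  choose r hr hur using fun t : Fin b => hu (p (Pi.single t 1))
  let G0 : (Fin b → R) →ₗ[R] R := Fintype.linearCombination R r
  let G : (Fin b → R) →ₗ[R] R ⧸ I := I.mkQ.comp G0
  have hG : (Submodule.factor (le_sup_left : I ≤ I ⊔ Ideal.span {x})).comp G = u.comp p := by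
    apply LinearMap.pi_ext'
    intro t
    ext
    simp only [LinearMap.comp_apply, LinearMap.coe_single, G, G0]
    rw [hur, Fintype.linearCombination_apply_single, one_smul]
    rfl
  have hmem : ∀ a, G (i a) ∈ LinearMap.range (LinearMap.lsmul R (R ⧸ I) x) := by
    intro a
    apply (h3 _).1
    have := LinearMap.congr_fun hG (i a)
    rw [LinearMap.comp_apply] at this
    rw [this, LinearMap.comp_apply, (he (i a)).2 ⟨a, rfl⟩, map_zero]
  let v : A →ₗ[R] R ⧸ I := (LinearEquiv.ofInjective (LinearMap.lsmul R (R ⧸ I) x) h1).symm.toLinearMap.comp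
    ((G.comp i).codRestrict _ hmem)
  have hv : ∀ a, LinearMap.lsmul R (R ⧸ I) x (v a) = G (i a) := by
    intro a
    have := LinearEquiv.apply_symm_apply (LinearEquiv.ofInjective (LinearMap.lsmul R (R ⧸ I) x) h1)
      ((G.comp i).codRestrict _ hmem a)
    exact congrArg Subtype.val this
  refine ⟨v, G, hG, LinearMap.ext hv, ?_⟩
  intro a
  obtain ⟨c, hc⟩ := Submodule.mkQ_surjective I (v a)
  refine ⟨c, ?_, hc.symm⟩
  by_contra hcm
  rw [mem_maximalIdeal, mem_nonunits_iff, not_not] at hcm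
  apply hx2
  have hG2 : G0 (i a) ∈ maximalIdeal R ^ 2 := by
    have h4 : ∀ f : Fin b → R, G0 f ∈ maximalIdeal R := by
      intro f
      rw [Fintype.linearCombination_apply]
      exact Ideal.sum_mem _ (fun t _ => Ideal.mul_mem_left _ _ (hr t))
    have h5 : (maximalIdeal R • (⊤ : Submodule R (Fin b → R))).map G0 ≤ maximalIdeal R ^ 2 := by
      rw [Submodule.map_smul'', pow_two, ← smul_eq_mul]
      refine Submodule.smul_mono le_rfl ?_
      rintro _ ⟨f, _, rfl⟩
      exact h4 f
    exact h5 ⟨_, hi a, rfl⟩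
  have h6 : x * c - G0 (i a) ∈ I := by
    rw [← Submodule.Quotient.eq]
    have := hv a
    rw [← hc] at this
    exact this
  have h7 : x * c ∈ maximalIdeal R ^ 2 ⊔ I := by
    have := Ideal.add_mem _ (Ideal.mem_sup_left hG2 : _ ∈ maximalIdeal R ^ 2 ⊔ I) (Ideal.mem_sup_right h6)
    simpa using this
  exact (Ideal.mul_unit_mem_iff_mem _ hcm).1 h7

lemma main_step (N : ModuleCat.{0} R) (j : ℕ) (I : Ideal R) (h : GoodSeq R j I)
    {A C : Type} [AddCommGroup A] [Module R A] [AddCommGroup C] [Module R C] {b : ℕ}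
    (i : A →ₗ[R] (Fin b → R)) (p : (Fin b → R) →ₗ[R] C)
    (hi : Function.Injective i) (hp : Function.Surjective p) (he : Function.Exact i p)
    (x : R) (hreg : ∀ a, x * a ∈ I → a ∈ I)
    (u : C →ₗ[R] R ⧸ (I ⊔ Ideal.span {x}))
    (v : A →ₗ[R] R ⧸ I) (G : (Fin b → R) →ₗ[R] R ⧸ I)
    (hG : (Submodule.factor (le_sup_left : I ≤ I ⊔ Ideal.span {x})).comp G = u.comp p)
    (hv : (LinearMap.lsmul R (R ⧸ I) x).comp v = G.comp i)
    (hsurj : ∀ y : Ext (ModuleCat.of R C) N (j+1),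
      ∃ z : Ext (ModuleCat.of R (R ⧸ (I ⊔ Ideal.span {x}))) N (j+1),
      (Ext.mk₀ (ModuleCat.ofHom u)).comp z (zero_add _) = y)
    (y : Ext (ModuleCat.of R A) N j) :
    ∃ (w : Ext (ModuleCat.of R (R ⧸ I)) N j) (x₂ : Ext (ModuleCat.of R (Fin b → R)) N j),
      y = (Ext.mk₀ (ModuleCat.ofHom v)).comp w (zero_add _) +
        (Ext.mk₀ (ModuleCat.ofHom i)).comp x₂ (zero_add _) := by
  obtain ⟨h1, h2, h3⟩ := quot_ses I x hreg
  have ht := ses_mk _ _ h1 h2 h3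
  have hs := ses_mk i p hi hp he
  let f : (ModuleCat.shortComplexOfCompEqZero i p he.linearMap_comp_eq_zero) ⟶
      (ModuleCat.shortComplexOfCompEqZero _ _ h3.linearMap_comp_eq_zero) :=
    { τ₁ := ModuleCat.ofHom v
      τ₂ := ModuleCat.ofHom G
      τ₃ := ModuleCat.ofHom u
      comm₁₂ := by
        apply ModuleCat.hom_ext
        exact hv
      comm₂₃ := by
        apply ModuleCat.hom_ext
        exact hG }
  have hnat := ShortComplex.ShortExact.extClass_naturality hs ht f
  obtain ⟨z, hz⟩ := hsurj (hs.extClass.comp y (add_comm 1 j))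
  have := h.pd N (j+1) (by omega)
  obtain ⟨w, hw⟩ := Ext.contravariant_sequence_exact₃ ht N z (Subsingleton.elim _ _)
        (add_comm 1 j)
  have hδ : hs.extClass.comp (y - (Ext.mk₀ (ModuleCat.ofHom v)).comp w (zero_add _))
      (add_comm 1 j) = 0 := by
    have e1 : hs.extClass.comp ((Ext.mk₀ f.τ₁).comp w (zero_add _)) (add_comm 1 j)
        = hs.extClass.comp y (add_comm 1 j) := by
      rw [← Ext.comp_assoc (a₁₂ := 1) _ _ _ (by omega) (by omega) (by omega), hnat,
        Ext.comp_assoc (a₂₃ := j + 1) _ _ _ (by omega) (by omega) (by omega), hw]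
      exact hz
    have e2 : hs.extClass.comp ((Ext.mk₀ (ModuleCat.ofHom v)).comp w (zero_add _)) (add_comm 1 j)
        = hs.extClass.comp y (add_comm 1 j) := e1
    have e3 : ∀ a c : Ext (ModuleCat.of R A) N j, hs.extClass.comp a (add_comm 1 j)
        = hs.extClass.comp c (add_comm 1 j) →
        hs.extClass.comp (c - a) (add_comm 1 j) = 0 := by
      intro a c hac
      have := ((hs.extClass).precomp N (add_comm 1 j)).map_sub c a
      refine this.trans ?_
      exact sub_eq_zero.2 hac.symm
    exact e3 _ _ e2
  obtain ⟨x₂, hx₂⟩ := Ext.contravariant_sequence_exact₁ hs N _ (add_comm 1 j) hδ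
  exact ⟨w, x₂, by
    rw [← sub_eq_iff_eq_add']
    exact hx₂.symm⟩

lemma main_map (N : ModuleCat.{0} R) (j : ℕ) (I : Ideal R) (h : GoodSeq R (j+1) I)
    (Ω : ℕ → ModuleCat.{0} R)
    (hΩ : ∀ j, ∃ (b : ℕ) (i : Ω (j+1) →ₗ[R] (Fin b → R)) (p : (Fin b → R) →ₗ[R] Ω j),
      Function.Injective i ∧ Function.Surjective p ∧ Function.Exact i p ∧
      ∀ a, i a ∈ maximalIdeal R • (⊤ : Submodule R (Fin b → R)))
    (u : Ω 0 →ₗ[R] R ⧸ I) (hu : ∀ c, ∃ r ∈ maximalIdeal R, u c = Submodule.Quotient.mk r)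
    (hsurj : ∀ y : Ext (ModuleCat.of R (Ω 0)) N (j+1), ∃ z : Ext (ModuleCat.of R (R ⧸ I)) N (j+1),
      (Ext.mk₀ (ModuleCat.ofHom u)).comp z (zero_add _) = y)
    (φ : Ω (j+1) →ₗ[R] N) (a : Ω (j+1)) : φ a ∈ maximalIdeal R • (⊤ : Submodule R N) := by
  induction j generalizing I Ω with
  | zero =>
    cases h with
    | succ _ I x h hx hx2 hreg =>
    obtain ⟨b, i, p, hi, hp, he, him⟩ := hΩ 0
    obtain ⟨v, G, hG, hv, hvm⟩ := step_lift i p he him I h.le x hx2 hreg u hu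
    obtain ⟨w, x₂, hw⟩ := main_step N 0 I h i p hi hp he x hreg u v G hG hv hsurj
      (Ext.mk₀ (ModuleCat.ofHom φ))
    obtain ⟨w, rfl⟩ := (Ext.mk₀_bijective _ _).2 w
    obtain ⟨x₂, rfl⟩ := (Ext.mk₀_bijective _ _).2 x₂
    rw [Ext.mk₀_comp_mk₀, Ext.mk₀_comp_mk₀, ← Ext.mk₀_add] at hw
    have hw := (Ext.mk₀_bijective _ _).1 hw
    have hφ : φ a = w.hom (v a) + x₂.hom (i a) := congrArg (fun f => f.hom a) hw
    rw [hφ]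
    refine Submodule.add_mem _ ?_ ?_
    · obtain ⟨r, hr, hvr⟩ := hvm a
      have : v a = r • (Submodule.Quotient.mk 1 : R ⧸ I) := by
        rw [hvr, ← Submodule.Quotient.mk_smul, smul_eq_mul, mul_one]
      rw [this, map_smul]
      exact Submodule.smul_mem_smul hr trivial
    · have : x₂.hom (i a) ∈ (maximalIdeal R • (⊤ : Submodule R (Fin b → R))).map x₂.hom :=
        ⟨_, him a, rfl⟩
      rw [Submodule.map_smul''] at this
      exact Submodule.smul_mono le_rfl le_top this
  | succ j ih =>
    cases h with
    | succ _ I x h hx hx2 hreg =>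
    obtain ⟨b, i, p, hi, hp, he, him⟩ := hΩ 0
    obtain ⟨v, G, hG, hv, hvm⟩ := step_lift i p he him I h.le x hx2 hreg u hu
    refine ih I h (fun n => Ω (n+1)) (fun n => hΩ (n+1)) v hvm ?_ φ a
    intro y
    obtain ⟨w, x₂, hw⟩ := main_step N (j+1) I h i p hi hp he x hreg u v G hG hv hsurj y
    have hx₂ : x₂ = 0 := Ext.eq_zero_of_projective _
    exact ⟨w, by rw [hw, hx₂]; simp⟩

end Aux2

section Aux3

variable {R : Type} [CommRing R] [IsLocalRing R]

lemma mu_add {N X S : Type} [AddCommGroup N] [Module R N] [AddCommGroup X] [Module R X]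
    [Module.Finite R X] [AddCommGroup S] [Module R S]
    (f : N →ₗ[R] X) (g : X →ₗ[R] S) (hg : Function.Surjective g) (he : Function.Exact f g)
    (hf : ∀ n, f n ∈ maximalIdeal R • (⊤ : Submodule R X) →
      n ∈ maximalIdeal R • (⊤ : Submodule R N)) :
    mu R X = mu R N + mu R S := by
  letI : Field (R ⧸ maximalIdeal R) := Ideal.Quotient.field _
  have hmapf : maximalIdeal R • (⊤ : Submodule R N) ≤
      (maximalIdeal R • (⊤ : Submodule R X)).comap f := by
    rw [← Submodule.map_le_iff_le_comap, Submodule.map_smul'']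
    exact Submodule.smul_mono le_rfl le_top
  have hmapg : maximalIdeal R • (⊤ : Submodule R X) ≤
      (maximalIdeal R • (⊤ : Submodule R S)).comap g := by
    rw [← Submodule.map_le_iff_le_comap, Submodule.map_smul'']
    exact Submodule.smul_mono le_rfl le_top
  let f' : (N ⧸ (maximalIdeal R • ⊤ : Submodule R N)) →ₗ[R ⧸ maximalIdeal R]
      (X ⧸ (maximalIdeal R • ⊤ : Submodule R X)) :=
    LinearMap.extendScalarsOfSurjective Ideal.Quotient.mk_surjective
      (Submodule.mapQ _ _ f hmapf)
  let g' : (X ⧸ (maximalIdeal R • ⊤ : Submodule R X)) →ₗ[R ⧸ maximalIdeal R]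
      (S ⧸ (maximalIdeal R • ⊤ : Submodule R S)) :=
    LinearMap.extendScalarsOfSurjective Ideal.Quotient.mk_surjective
      (Submodule.mapQ _ _ g hmapg)
  have hf' : Function.Injective f' := by
    rw [injective_iff_map_eq_zero]
    intro a ha
    obtain ⟨a, rfl⟩ := Submodule.mkQ_surjective _ a
    have h1 : (Submodule.Quotient.mk (f a) : X ⧸ (maximalIdeal R • ⊤ : Submodule R X)) = 0 := ha
    rw [Submodule.Quotient.mk_eq_zero] at h1
    exact (Submodule.Quotient.mk_eq_zero _).2 (hf a h1)
  have hg' : Function.Surjective g' := by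
    intro s
    obtain ⟨s, rfl⟩ := Submodule.mkQ_surjective _ s
    obtain ⟨x, rfl⟩ := hg s
    exact ⟨Submodule.mkQ _ x, rfl⟩
  have hker : LinearMap.ker g' = LinearMap.range f' := by
    ext a
    obtain ⟨x, rfl⟩ := Submodule.mkQ_surjective _ a
    rw [LinearMap.mem_ker, LinearMap.mem_range]
    constructor
    · intro ha
      have h1 : (Submodule.Quotient.mk (g x) : S ⧸ (maximalIdeal R • ⊤ : Submodule R S)) = 0 := ha
      rw [Submodule.Quotient.mk_eq_zero] at h1
      have h2 : (maximalIdeal R • (⊤ : Submodule R S)) =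
          (maximalIdeal R • (⊤ : Submodule R X)).map g := by
        rw [Submodule.map_smul'', Submodule.map_top, LinearMap.range_eq_top.2 hg]
      rw [h2] at h1
      obtain ⟨y, hy, hyx⟩ := h1
      obtain ⟨n, hn⟩ := (he (x - y)).1 (by rw [map_sub, hyx, sub_self])
      refine ⟨Submodule.mkQ _ n, ?_⟩
      have h3 : (Submodule.Quotient.mk (f n) : X ⧸ (maximalIdeal R • ⊤ : Submodule R X)) =
          Submodule.Quotient.mk x := by
        rw [Submodule.Quotient.eq, hn]
        have : x - y - x = -y := by abel
        rw [this]
        exact Submodule.neg_mem _ hy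
      exact h3
    · rintro ⟨n, hn⟩
      obtain ⟨n, rfl⟩ := Submodule.mkQ_surjective _ n
      rw [← hn]
      have : (Submodule.Quotient.mk (g (f n)) : S ⧸ (maximalIdeal R • ⊤ : Submodule R S)) = 0 := by
        rw [he.apply_apply_eq_zero]; rfl
      exact this
  have hfin : Module.Finite (R ⧸ maximalIdeal R) (X ⧸ (maximalIdeal R • ⊤ : Submodule R X)) :=
    Module.Finite.of_restrictScalars_finite R _ _
  have h1 := LinearMap.finrank_range_add_finrank_ker g'
  rw [hker, LinearMap.finrank_range_of_inj hf', LinearMap.range_eq_top.2 hg', finrank_top] at h1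
  unfold mu
  rw [← h1, add_comm]

lemma mu_add' {N X S A : Type} [AddCommGroup N] [Module R N] [AddCommGroup X] [Module R X]
    [Module.Finite R X] [AddCommGroup S] [Module R S] [AddCommGroup A] [Module R A] {b : ℕ}
    (i : A →ₗ[R] (Fin b → R)) (p : (Fin b → R) →ₗ[R] S)
    (hp : Function.Surjective p) (hip : Function.Exact i p)
    (hA : ∀ (φ : A →ₗ[R] N) (a : A), φ a ∈ maximalIdeal R • (⊤ : Submodule R N))
    (f : N →ₗ[R] X) (g : X →ₗ[R] S) (hf : Function.Injective f)
    (hg : Function.Surjective g) (he : Function.Exact f g) :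
    mu R X = mu R N + mu R S := by
  apply mu_add f g hg he
  obtain ⟨l, hl⟩ := Module.projective_lifting_property g p hg
  have hl' : ∀ q, g (l q) = p q := fun q => LinearMap.congr_fun hl q
  have hmem : ∀ a, l (i a) ∈ LinearMap.range f := by
    intro a
    apply (he _).1
    rw [hl', hip.apply_apply_eq_zero]
  let φ : A →ₗ[R] N := (LinearEquiv.ofInjective f hf).symm.toLinearMap.comp
    ((l.comp i).codRestrict _ hmem)
  have hφ : ∀ a, f (φ a) = l (i a) := by
    intro a
    have := LinearEquiv.apply_symm_apply (LinearEquiv.ofInjective f hf)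
      ((l.comp i).codRestrict _ hmem a)
    exact congrArg Subtype.val this
  -- every element of `mX` is `f n + l q` with `n ∈ mN`
  have key : ∀ x ∈ maximalIdeal R • (⊤ : Submodule R X),
      ∃ n ∈ maximalIdeal R • (⊤ : Submodule R N), ∃ q, x = f n + l q := by
    intro x hx
    induction hx using Submodule.smul_induction_on' with
    | smul r hr x hx =>
      obtain ⟨q, hq⟩ := hp (g x)
      obtain ⟨n, hn⟩ := (he (x - l q)).1 (by rw [map_sub, hl', hq, sub_self])
      refine ⟨r • n, Submodule.smul_mem_smul hr trivial, r • q, ?_⟩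
      rw [map_smul, map_smul, ← smul_add, hn, sub_add_cancel]
    | add x hx y hy h1 h2 =>
      obtain ⟨n, hn, q, rfl⟩ := h1
      obtain ⟨n', hn', q', rfl⟩ := h2
      exact ⟨n + n', Submodule.add_mem _ hn hn', q + q', by rw [map_add, map_add]; abel⟩
  intro n hn
  obtain ⟨n', hn', q, hq⟩ := key _ hn
  have h1 : p q = 0 := by
    have h2 := congrArg g hq
    rw [map_add, he.apply_apply_eq_zero, he.apply_apply_eq_zero, zero_add, hl'] at h2
    exact h2.symm
  obtain ⟨a, rfl⟩ := (hip q).1 h1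
  rw [← hφ, ← map_add] at hq
  rw [hf hq]
  exact Submodule.add_mem _ hn' (hA φ a)

lemma nonsplit_of_not_extend {N S A P : Type} [AddCommGroup N] [Module R N] [Module.Finite R N]
    [AddCommGroup S] [Module R S] [AddCommGroup A] [Module R A]
    [AddCommGroup P] [Module R P] [Module.Finite R P]
    (i : A →ₗ[R] P) (p : P →ₗ[R] S) (hi : Function.Injective i)
    (hp : Function.Surjective p) (hip : Function.Exact i p)
    (φ : A →ₗ[R] N) (hφ : ¬ ∃ ψ : P →ₗ[R] N, ψ.comp i = φ) :
    ∃ (X : ModuleCat.{0} R) (_ : Module.Finite R ↥X)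
      (f : N →ₗ[R] ↥X) (g : ↥X →ₗ[R] S),
      Function.Injective f ∧ Function.Surjective g ∧ Function.Exact f g ∧
      ¬ ∃ s : S →ₗ[R] ↥X, g ∘ₗ s = LinearMap.id := by
  let K : Submodule R (N × P) := LinearMap.range (φ.prod (-i))
  have hK : K ≤ LinearMap.ker (p.comp (LinearMap.snd R N P)) := by
    rintro _ ⟨a, rfl⟩
    simp [hip.apply_apply_eq_zero]
  let f : N →ₗ[R] (N × P) ⧸ K := K.mkQ.comp (LinearMap.inl R N P)
  let g : ((N × P) ⧸ K) →ₗ[R] S := K.liftQ (p.comp (LinearMap.snd R N P)) hK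
  have hgm : ∀ n q, g (K.mkQ (n, q)) = p q := fun n q => rfl
  have hfm : ∀ a, K.mkQ (0, i a) = f (φ a) := by
    intro a
    refine (Submodule.Quotient.eq K).2 ?_
    refine ⟨-a, ?_⟩
    simp
  have hf : Function.Injective f := by
    rw [injective_iff_map_eq_zero]
    intro n hn
    obtain ⟨a, ha⟩ := (Submodule.Quotient.mk_eq_zero K).1 hn
    have h1 : φ a = n := congrArg Prod.fst ha
    have h2 : - i a = 0 := congrArg Prod.snd ha
    have h3 : a = 0 := hi (by rw [map_zero]; exact neg_eq_zero.1 h2)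
    rw [← h1, h3, map_zero]
  have hg : Function.Surjective g := by
    intro s
    obtain ⟨q, rfl⟩ := hp s
    exact ⟨K.mkQ (0, q), rfl⟩
  have he : Function.Exact f g := by
    intro x
    obtain ⟨⟨n, q⟩, rfl⟩ := K.mkQ_surjective x
    constructor
    · intro h
      rw [hgm] at h
      obtain ⟨a, rfl⟩ := (hip q).1 h
      refine ⟨n + φ a, ?_⟩
      rw [map_add, ← hfm]
      change K.mkQ (n, 0) + _ = _
      rw [← map_add]
      simp
    · rintro ⟨n', hn'⟩
      rw [← hn']
      exact (hgm n' 0).trans (map_zero p)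
  refine ⟨ModuleCat.of R ((N × P) ⧸ K), inferInstanceAs (Module.Finite R ((N × P) ⧸ K)),
    f, g, hf, hg, he, ?_⟩
  rintro ⟨s, hs⟩
  apply hφ
  have hs' : ∀ y, g (s y) = y := fun y => LinearMap.congr_fun hs y
  let t : ((N × P) ⧸ K) →ₗ[R] ((N × P) ⧸ K) := LinearMap.id - s.comp g
  have ht : ∀ x, t x ∈ LinearMap.range f := by
    intro x
    apply (he _).1
    change g (x - s (g x)) = 0
    rw [map_sub, hs', sub_self]
  let r : ((N × P) ⧸ K) →ₗ[R] N := (LinearEquiv.ofInjective f hf).symm.toLinearMap.comp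
    (t.codRestrict _ ht)
  have hr : ∀ n, r (f n) = n := by
    intro n
    apply hf
    have := LinearEquiv.apply_symm_apply (LinearEquiv.ofInjective f hf)
      (t.codRestrict _ ht (f n))
    refine (congrArg Subtype.val this).trans ?_
    change f n - s (g (f n)) = f n
    rw [he.apply_apply_eq_zero, map_zero, sub_zero]
  refine ⟨r.comp (K.mkQ.comp (LinearMap.inr R N P)), ?_⟩
  ext a
  change r (K.mkQ (0, i a)) = φ a
  rw [hfm, hr]

lemma ext_shift (N : ModuleCat.{0} R) {A C : Type} [AddCommGroup A] [Module R A]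
    [AddCommGroup C] [Module R C] {b : ℕ} (j : ℕ)
    (i : A →ₗ[R] (Fin b → R)) (p : (Fin b → R) →ₗ[R] C)
    (hi : Function.Injective i) (hp : Function.Surjective p) (he : Function.Exact i p)
    (h : Nontrivial (Ext (ModuleCat.of R C) N (j+1))) :
    ∃ w : Ext (ModuleCat.of R A) N j, ¬ ∃ x : Ext (ModuleCat.of R (Fin b → R)) N j,
      (Ext.mk₀ (ModuleCat.ofHom i)).comp x (zero_add _) = w := by
  have hs := ses_mk i p hi hp he
  obtain ⟨y, hy⟩ := exists_ne (0 : Ext (ModuleCat.of R C) N (j+1))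
  obtain ⟨w, hw⟩ := Ext.contravariant_sequence_exact₃ hs N y
    (Ext.eq_zero_of_projective (P := ModuleCat.of R (Fin b → R)) _) (add_comm 1 j)
  refine ⟨w, ?_⟩
  rintro ⟨x, rfl⟩
  apply hy
  rw [← hw]
  exact hs.extClass_comp_assoc x

lemma ext_shift_iter (N : ModuleCat.{0} R) (j : ℕ) (Ω : ℕ → ModuleCat.{0} R)
    (hΩ : ∀ j, ∃ (b : ℕ) (i : Ω (j+1) →ₗ[R] (Fin b → R)) (p : (Fin b → R) →ₗ[R] Ω j),
      Function.Injective i ∧ Function.Surjective p ∧ Function.Exact i p ∧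
      ∀ a, i a ∈ maximalIdeal R • (⊤ : Submodule R (Fin b → R)))
    (h : Nontrivial (Ext (ModuleCat.of R (Ω 0)) N (j+1))) :
    Nontrivial (Ext (ModuleCat.of R (Ω j)) N 1) := by
  induction j generalizing Ω with
  | zero => exact h
  | succ j ih =>
    refine ih (fun n => Ω (n+1)) (fun n => hΩ (n+1)) ?_
    obtain ⟨b, i, p, hi, hp, he, -⟩ := hΩ 0
    obtain ⟨w, hw⟩ := ext_shift N (j+1) i p hi hp he h
    refine ⟨w, 0, ?_⟩
    rintro rfl
    exact hw ⟨0, by simp⟩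

lemma syzygy_data {i : ℕ} {S : Type} [AddCommGroup S] [Module R S]
    (hS : IsMinSyzygyOfResidueField R i S) :
    ∃ Ω : ℕ → ModuleCat.{0} R, Ω 0 = ModuleCat.of R (R ⧸ maximalIdeal R) ∧
    (∀ j, ∃ (b : ℕ) (i : Ω (j+1) →ₗ[R] (Fin b → R)) (p : (Fin b → R) →ₗ[R] Ω j),
      Function.Injective i ∧ Function.Surjective p ∧ Function.Exact i p ∧
      ∀ a, i a ∈ maximalIdeal R • (⊤ : Submodule R (Fin b → R))) ∧
    Nonempty (S ≃ₗ[R] Ω i) := by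
  obtain ⟨b, f, ε, hε, h0, hf, hm0, hm, hcase⟩ := hS
  let Ω : ℕ → ModuleCat.{0} R := fun n => Nat.casesOn n (ModuleCat.of R (R ⧸ maximalIdeal R))
    (fun j => ModuleCat.of R (LinearMap.range (f j)))
  refine ⟨Ω, rfl, ?_, ?_⟩
  · intro j
    cases j with
    | zero =>
      refine ⟨b 0, (LinearMap.range (f 0)).subtype, ε, Submodule.subtype_injective _, hε, ?_, ?_⟩
      · intro x
        rw [h0 x]
        exact ⟨fun h => ⟨⟨x, h⟩, rfl⟩, by rintro ⟨y, rfl⟩; exact y.2⟩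
      · intro a
        exact hm 0 a.2
    | succ j =>
      refine ⟨b (j+1), (LinearMap.range (f (j+1))).subtype, (f j).rangeRestrict,
        Submodule.subtype_injective _, LinearMap.surjective_rangeRestrict _, ?_, ?_⟩
      · intro x
        constructor
        · intro h
          exact ⟨⟨x, (hf j x).1 (congrArg Subtype.val h)⟩, rfl⟩
        · rintro ⟨y, rfl⟩
          exact Subtype.ext ((hf j _).2 y.2)
      · intro a
        exact hm (j+1) a.2
  · rcases hcase with ⟨rfl, e⟩ | ⟨j, rfl, e⟩
    · exact e
    · exact e

lemma main_aux [IsNoetherianRing R]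
    (hnonreg : ¬ IsRegularLocal R)
    (d : ℕ) (hdim : ringKrullDim R = (d + 1 : ℕ)) (hCM : depthGE R R (d + 1))
    (S : Type) [AddCommGroup S] [Module R S]
    (hS : IsMinSyzygyOfResidueField R d S)
    (N : Type) [AddCommGroup N] [Module R N] [Module.Finite R N]
    (hN : Nontrivial N) (hinj : HasFiniteInjDim R N) :
    ∃ (A : Type) (_ : AddCommGroup A) (_ : Module R A) (b : ℕ) (i : A →ₗ[R] (Fin b → R))
      (p : (Fin b → R) →ₗ[R] S), Function.Injective i ∧ Function.Surjective p ∧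
      Function.Exact i p ∧
      (∀ (φ : A →ₗ[R] N) (a : A), φ a ∈ maximalIdeal R • (⊤ : Submodule R N)) ∧
      ∃ φ : A →ₗ[R] N, ¬ ∃ ψ : (Fin b → R) →ₗ[R] N, ψ.comp i = φ := by
  obtain ⟨rs, hlen, hrs, hreg⟩ := hCM
  have hdepth := extDepth_of_regular rs hrs (ModuleCat.of R R) hreg.toIsWeaklyRegular
  rw [hlen] at hdepth
  obtain ⟨I, hI⟩ := exists_goodSeq (d+1) hdepth
  obtain ⟨n, hn⟩ := hI.pow_le hdim
  have hne : I ≠ maximalIdeal R := by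
    rintro rfl
    obtain ⟨x, hx⟩ := hI.span
    exact hnonreg ⟨d+1, x, hx, hdim⟩
  obtain ⟨s, hs, hsI, hsoc⟩ := exists_soc hI.le hne n hn
  have hy0 : (Ideal.Quotient.mk I s) ≠ 0 := by
    rwa [Ne, Ideal.Quotient.eq_zero_iff_mem]
  have hy : ∀ a ∈ maximalIdeal R, a • (Ideal.Quotient.mk I s) = 0 := by
    intro a ha
    exact Ideal.Quotient.eq_zero_iff_mem.2 (hsoc a ha)
  obtain ⟨B, hB⟩ := injdim_bound hinj
  have hvan := ext_residue_vanish (ModuleCat.of R N) hI n hn _ hy0 hy B hB (d+1+1) (by omega)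
  obtain ⟨Ω, hΩ0, hΩ, ⟨e⟩⟩ := syzygy_data hS
  have hmain : ∀ (φ : Ω (d+1) →ₗ[R] N) (a : Ω (d+1)),
      φ a ∈ maximalIdeal R • (⊤ : Submodule R N) := by
    let θ : Ω 0 ≅ ModuleCat.of R (R ⧸ maximalIdeal R) := eqToIso hΩ0
    let u : Ω 0 →ₗ[R] R ⧸ I := (socMap _ hy).comp θ.hom.hom
    refine main_map (ModuleCat.of R N) d I hI Ω hΩ u ?_ ?_
    · intro c
      obtain ⟨a, ha⟩ := Ideal.Quotient.mk_surjective (θ.hom.hom c)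
      refine ⟨a * s, Ideal.mul_mem_left _ _ hs, ?_⟩
      change socMap _ hy (θ.hom.hom c) = _
      rw [← ha, socMap_mk]
      rfl
    · intro y
      obtain ⟨z, hz⟩ := soc_surj (ModuleCat.of R N) I n hn _ hy0 hy (d+1) hvan
        ((Ext.mk₀ θ.inv).comp y (zero_add _))
      refine ⟨z, ?_⟩
      have h1 : (Ext.mk₀ θ.hom).comp ((Ext.mk₀ (ModuleCat.ofHom (socMap _ hy))).comp z
          (zero_add _)) (zero_add _) = (Ext.mk₀ θ.hom).comp ((Ext.mk₀ θ.inv).comp y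
          (zero_add _)) (zero_add _) := by rw [hz]
      rw [Ext.mk₀_comp_mk₀_assoc, Ext.mk₀_comp_mk₀_assoc, Iso.hom_inv_id,
        Ext.mk₀_id_comp] at h1
      exact h1
  have hnt : Nontrivial (Ext (ModuleCat.of R (Ω 0)) (ModuleCat.of R N) (d+1)) := by
    rw [hΩ0]
    by_contra hcon
    rw [not_nontrivial_iff_subsingleton] at hcon
    have h1 := ext_finlen (ModuleCat.of R N) (d+1) hcon (R ⧸ I) inferInstance n (by
      intro a ha x
      obtain ⟨x, rfl⟩ := Ideal.Quotient.mk_surjective x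
      exact Ideal.Quotient.eq_zero_iff_mem.2 (Ideal.mul_mem_right _ _ (hn ha)))
    have : Module.Finite R (ModuleCat.of R N) := inferInstanceAs (Module.Finite R N)
    have : Nontrivial (ModuleCat.of R N) := hN
    have h2 := GoodSeq.nontrivial (ModuleCat.of R N) hI
    exact not_subsingleton _ h1
  have hnt1 := ext_shift_iter (ModuleCat.of R N) d Ω hΩ hnt
  obtain ⟨b, i, p, hi, hp, he, him⟩ := hΩ d
  refine ⟨Ω (d+1), inferInstance, inferInstance, b, i, e.symm.toLinearMap.comp p, hi,
    e.symm.surjective.comp hp, ?_, hmain, ?_⟩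
  · intro x
    rw [← he x]
    exact LinearEquiv.map_eq_zero_iff e.symm
  · obtain ⟨w, hw⟩ := ext_shift (ModuleCat.of R N) 0 i p hi hp he hnt1
    obtain ⟨w, rfl⟩ := (Ext.mk₀_bijective _ _).2 w
    refine ⟨w.hom, ?_⟩
    rintro ⟨ψ, hψ⟩
    apply hw
    refine ⟨Ext.mk₀ (ModuleCat.ofHom ψ), ?_⟩
    rw [Ext.mk₀_comp_mk₀]
    congr 1
    exact ModuleCat.hom_ext hψ

end Aux3

end MuAdd

/-- Let `(R,𝔪,k)` be a non-regular Cohen–Macaulay Noetherian local ring of dimension `d ≥ 1`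
and `N ≠ 0` finitely generated of finite injective dimension.  Then every short exact
sequence `0 → N → X → Ω^{d-1} k → 0` of finitely generated modules is `μ`-additive, and
there exists a non-split such sequence; i.e.
`Ext¹_R(Ω^{d-1} k, N)^μ = Ext¹_R(Ω^{d-1} k, N) ≠ 0`. -/
theorem stmt4 (R : Type) [CommRing R] [IsLocalRing R] [IsNoetherianRing R]
    (hnonreg : ¬ IsRegularLocal R)
    (d : ℕ) (hd : 1 ≤ d) (hdim : ringKrullDim R = d) (hCM : depthGE R R d)
    (S : Type) [AddCommGroup S] [Module R S] [Module.Finite R S]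
    (hS : IsMinSyzygyOfResidueField R (d - 1) S)
    (N : Type) [AddCommGroup N] [Module R N] [Module.Finite R N]
    (hN : Nontrivial N) (hinj : HasFiniteInjDim R N) :
    (∀ (X : Type) [AddCommGroup X] [Module R X] [Module.Finite R X]
      (f : N →ₗ[R] X) (g : X →ₗ[R] S),
      Function.Injective f → Function.Surjective g → Function.Exact f g →
      mu R X = mu R N + mu R S) ∧
    (∃ (X : ModuleCat.{0} R) (_ : Module.Finite R ↥X)
      (f : N →ₗ[R] ↥X) (g : ↥X →ₗ[R] S),
      Function.Injective f ∧ Function.Surjective g ∧ Function.Exact f g ∧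
      ¬ ∃ s : S →ₗ[R] ↥X, g ∘ₗ s = LinearMap.id) := by
  obtain ⟨d, rfl⟩ : ∃ e, d = e + 1 := ⟨d - 1, by omega⟩
  obtain ⟨A, _, _, b, i, p, hi, hp, he, hA, φ, hφ⟩ :=
    MuAdd.main_aux hnonreg d hdim hCM S hS N hN hinj
  refine ⟨?_, MuAdd.nonsplit_of_not_extend i p hi hp he φ hφ⟩
  intro X _ _ _ f g hf hg hfg
  exact MuAdd.mu_add' i p hp he hA f g hf hg hfg
end
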